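/- arXiv:2107.13605 — 3 statements merged into one kernel-verified Lean document; each statement's English description precedes it below -/
import Mathlib

section
/- Let ι : H' → H be a continuous injective linear map between complex Hilbert spaces with closed range, and let A be a compact operator on H'. Then for every complex number λ ≠ 0 the operators A and ι_*A have the same algebraic multiplicity at λ, i.e. dim(⋃_{ℓ≥1} ker(A − λ)^ℓ) = dim(⋃_{ℓ≥1} ker(ι_*A − λ)^ℓ); in particular A and ι_*A have the same nonzero eigenvalues with the same algebraic multiplicities. -/
open Filter MeasureTheory

universe u v

/-- Singular values via the Courant–Fischer / approximation-number formula: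
`μ_j(T) = inf { sup { ‖Tξ‖ : ξ ∈ Eᗮ, ‖ξ‖ = 1 } : dim E = j }`. -/
noncomputable def sv {H : Type u} [NormedAddCommGroup H] [InnerProductSpace ℂ H]
    (T : H →L[ℂ] H) (j : ℕ) : ℝ :=
  ⨅ E : {E : Submodule ℂ H // Module.finrank ℂ E = j},
    ⨆ ξ : {ξ : H // ξ ∈ (E.1)ᗮ ∧ ‖ξ‖ = 1}, ‖T ξ.1‖

/-- `B` is the pushforward `ι_*A = ι ∘ A ∘ (ι⁻¹ ∘ π)`, characterized by `B ∘ ι = ι ∘ A`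
together with `B = 0` on the orthogonal complement of the range of `ι`. -/
def IsPushforward {H : Type u} {H' : Type v} [NormedAddCommGroup H] [InnerProductSpace ℂ H]
    [NormedAddCommGroup H'] [InnerProductSpace ℂ H']
    (ι : H' →L[ℂ] H) (A : H' →L[ℂ] H') (B : H →L[ℂ] H) : Prop :=
  (∀ y, B (ι y) = ι (A y)) ∧ ∀ x ∈ (LinearMap.range (ι : H' →ₗ[ℂ] H))ᗮ, B x = 0

/-- Algebraic multiplicity of `z` as an eigenvalue of `A`:
the dimension of `⋃_{ℓ ≥ 1} ker (A - z)^ℓ`. -/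
noncomputable def algMult {H : Type u} [NormedAddCommGroup H] [InnerProductSpace ℂ H]
    (A : H →L[ℂ] H) (z : ℂ) : Cardinal.{u} :=
  Module.rank ℂ
    ↥(⨆ ℓ : ℕ, LinearMap.ker (((A : H →ₗ[ℂ] H) - z • LinearMap.id) ^ ℓ))

/-- If an injective linear map `i` intertwines `f` and `g`, and `g` takes values in the range of
`i`, then `i` identifies the kernels of the powers of `f - z` and `g - z` for `z ≠ 0`. -/
theorem map_ker_sub_smul_pow_of_intertwine {K : Type*} {V : Type*} {W : Type*} [Field K]
    [AddCommGroup V] [Module K V] [AddCommGroup W] [Module K W]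
    {i : V →ₗ[K] W} (hi : Function.Injective i) {f : V →ₗ[K] V} {g : W →ₗ[K] W}
    (hfg : ∀ y, g (i y) = i (f y)) (hg : ∀ x, g x ∈ LinearMap.range i)
    {z : K} (hz : z ≠ 0) (n : ℕ) :
    (LinearMap.ker ((f - z • LinearMap.id) ^ n)).map i =
      LinearMap.ker ((g - z • LinearMap.id) ^ n) := by
  have hpow : ∀ (n : ℕ) (y : V),
      ((g - z • LinearMap.id) ^ n : W →ₗ[K] W) (i y) =
        i (((f - z • LinearMap.id) ^ n : V →ₗ[K] V) y) := by
    intro n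
    induction n with
    | zero => simp
    | succ n ih => intro y; simp [pow_succ, ← ih, hfg]
  have hmem : ∀ (n : ℕ) (x : W),
      ((g - z • LinearMap.id) ^ n : W →ₗ[K] W) x ∈ LinearMap.range i → x ∈ LinearMap.range i := by
    intro n
    induction n with
    | zero => simp
    | succ n ih =>
      intro x hx
      rw [pow_succ, Module.End.mul_apply] at hx
      have h := (Submodule.sub_mem_iff_right _ (hg x)).1 (ih _ hx)
      exact (Submodule.smul_mem_iff _ hz).1 h
  ext x
  constructor
  · rintro ⟨y, hy, rfl⟩
    rw [LinearMap.mem_ker, hpow, LinearMap.mem_ker.1 hy, map_zero]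
  · intro hx
    rw [LinearMap.mem_ker] at hx
    obtain ⟨y, rfl⟩ := hmem n x (hx ▸ zero_mem _)
    refine ⟨y, hi ?_, rfl⟩
    rw [← hpow, hx, map_zero]

/-- A pushforward along a map with closed range takes values in that range. -/
theorem IsPushforward.apply_mem_range {H : Type u} {H' : Type v}
    [NormedAddCommGroup H] [InnerProductSpace ℂ H] [CompleteSpace H]
    [NormedAddCommGroup H'] [InnerProductSpace ℂ H']
    {ι : H' →L[ℂ] H} (hrange : IsClosed (Set.range ⇑ι)) {A : H' →L[ℂ] H'} {B : H →L[ℂ] H}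
    (hB : IsPushforward ι A B) (x : H) : B x ∈ LinearMap.range (ι : H' →ₗ[ℂ] H) := by
  have : CompleteSpace (LinearMap.range (ι : H' →ₗ[ℂ] H)) := hrange.completeSpace_coe
  obtain ⟨_, ⟨y, rfl⟩, w, hw, rfl⟩ :=
    (LinearMap.range (ι : H' →ₗ[ℂ] H)).exists_add_mem_mem_orthogonal x
  rw [map_add, hB.2 w hw, add_zero]
  exact ⟨A y, (hB.1 y).symm⟩

/-- If `ι : H' → H` is a continuous injective linear map with closed range and `A` is a compact
operator on `H'`, then for every `λ ≠ 0` the operators `A` and `ι_*A` have the same algebraic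
multiplicity at `λ`; in particular they have the same nonzero eigenvalues with the same
algebraic multiplicities. -/
theorem pushforward_algMult_eq {H : Type u} {H' : Type v}
    [NormedAddCommGroup H] [InnerProductSpace ℂ H] [CompleteSpace H]
    [NormedAddCommGroup H'] [InnerProductSpace ℂ H'] [CompleteSpace H']
    (ι : H' →L[ℂ] H) (hinj : Function.Injective ⇑ι) (hrange : IsClosed (Set.range ⇑ι))
    (A : H' →L[ℂ] H') (hA : IsCompactOperator ⇑A)
    (B : H →L[ℂ] H) (hB : IsPushforward ι A B)
    (z : ℂ) (hz : z ≠ 0) :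
    Cardinal.lift.{u} (algMult A z) = Cardinal.lift.{v} (algMult B z) := by
  have hmap := (Submodule.map_iSup _ _).trans <| iSup_congr <|
    map_ker_sub_smul_pow_of_intertwine (i := (ι : H' →ₗ[ℂ] H)) (f := (A : H' →ₗ[ℂ] H'))
      (g := (B : H →ₗ[ℂ] H)) hinj hB.1 (hB.apply_mem_range hrange) hz
  rw [algMult, algMult, ← hmap]
  exact (Submodule.equivMapOfInjective (ι : H' →ₗ[ℂ] H) hinj _).lift_rank_eq
end

section
/- Let p > 0 and let (A_k)_{k≥1} be a sequence of self-adjoint operators in 𝓛_{p,∞} on a complex Hilbert space such that for each k the limits Λ^+(A_k) = lim_{j→∞} j^{1/p} λ_j^+(A_k) and Λ^-(A_k) = lim_{j→∞} j^{1/p} λ_j^-(A_k) exist. Suppose A is self-adjoint and ‖A_k − A‖_{p,∞} → 0 as k → ∞. Then the limits Λ^±(A) = lim_{j→∞} j^{1/p} λ_j^±(A) exist, and Λ^+(A_k) → Λ^+(A) and Λ^-(A_k) → Λ^-(A) as k → ∞. -/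
open Filter MeasureTheory

universe u v

/-- Membership in the weak Schatten class `𝓛_{p,∞}`: compactness together with
`sup_j (j+1)^{1/p} μ_j(T) < ∞`. -/
def MemWeak {H : Type u} [NormedAddCommGroup H] [InnerProductSpace ℂ H]
    (p : ℝ) (T : H →L[ℂ] H) : Prop :=
  IsCompactOperator ⇑T ∧ ∃ C : ℝ, ∀ j : ℕ, ((j : ℝ) + 1) ^ (1 / p) * sv T j ≤ C

/-- The weak Schatten quasi-norm `‖T‖_{p,∞} = sup_{j ≥ 0} (j+1)^{1/p} μ_j(T)`. -/
noncomputable def weakNorm {H : Type u} [NormedAddCommGroup H] [InnerProductSpace ℂ H]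
    (p : ℝ) (T : H →L[ℂ] H) : ℝ :=
  ⨆ j : ℕ, ((j : ℝ) + 1) ^ (1 / p) * sv T j

/-- `P` and `N` are the positive and negative parts `A_± = (|A| ± A)/2` of the self-adjoint
operator `A`, characterized by `A = P - N`, `P, N ≥ 0` and `P N = 0`.
Then `λ_j^+(A) = μ_j(P)` and `λ_j^-(A) = μ_j(N)`. -/
def IsPosNegDecomp {H : Type u} [NormedAddCommGroup H] [InnerProductSpace ℂ H] [CompleteSpace H]
    (A P N : H →L[ℂ] H) : Prop :=
  A = P - N ∧ P.IsPositive ∧ N.IsPositive ∧ P ∘L N = 0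

theorem rpow_mul_add_le {s t d : ℕ → ℝ} {q e a b : ℝ} (hq : 0 ≤ q) (ht : ∀ i, 0 ≤ t i)
    (hd0 : ∀ j, 0 ≤ d j) (hd : ∀ j : ℕ, ((j : ℝ) + 1) ^ q * d j ≤ e) (ha : 0 ≤ a) (hb : 0 ≤ b)
    {n i j : ℕ} (hs : s n ≤ t i + d j) (hni : (n : ℝ) ≤ a * i) (hnj : (n : ℝ) ≤ b * (j + 1)) :
    (n : ℝ) ^ q * s n ≤ a ^ q * ((i : ℝ) ^ q * t i) + b ^ q * e := by
  have h1 : (n : ℝ) ^ q ≤ a ^ q * (i : ℝ) ^ q := by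
    rw [← Real.mul_rpow ha (by positivity)]
    exact Real.rpow_le_rpow (by positivity) hni hq
  have h2 : (n : ℝ) ^ q ≤ b ^ q * ((j : ℝ) + 1) ^ q := by
    rw [← Real.mul_rpow hb (by positivity)]
    exact Real.rpow_le_rpow (by positivity) hnj hq
  calc (n : ℝ) ^ q * s n ≤ (n : ℝ) ^ q * t i + (n : ℝ) ^ q * d j := by
        rw [← mul_add]; exact mul_le_mul_of_nonneg_left hs (by positivity)
    _ ≤ a ^ q * (i : ℝ) ^ q * t i + b ^ q * ((j : ℝ) + 1) ^ q * d j :=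
        add_le_add (mul_le_mul_of_nonneg_right h1 (ht i)) (mul_le_mul_of_nonneg_right h2 (hd0 j))
    _ ≤ a ^ q * ((i : ℝ) ^ q * t i) + b ^ q * e := by
        rw [mul_assoc, mul_assoc]
        gcongr
        exact hd j

section

open Topology

/-- Two-sided approximate comparisons of `f` with convergent sequences `g k`, with multiplicative
errors tending to `1` and additive errors tending to `0`, force `f` and the limits of the `g k` to
converge to the same limit. -/
theorem exists_tendsto_of_approx {f : ℕ → ℝ} {g : ℕ → ℕ → ℝ} {L e : ℕ → ℝ} {α β a b : ℝ → ℝ}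
    {φ ψ : ℝ → ℕ → ℕ} (hf : ∀ n, 0 ≤ f n) (hg : ∀ k, Tendsto (g k) atTop (𝓝 (L k)))
    (he : Tendsto e atTop (𝓝 0)) (hα : Tendsto α (𝓝[>] 0) (𝓝 1))
    (hβ : Tendsto β (𝓝[>] 0) (𝓝 1))
    (hφ : ∀ δ ∈ Set.Ioo (0 : ℝ) 1, Tendsto (φ δ) atTop atTop)
    (hψ : ∀ δ ∈ Set.Ioo (0 : ℝ) 1, Tendsto (ψ δ) atTop atTop)
    (hfg : ∀ δ ∈ Set.Ioo (0 : ℝ) 1, ∀ k, ∀ᶠ n in atTop, f n ≤ α δ * g k (φ δ n) + a δ * e k)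
    (hgf : ∀ δ ∈ Set.Ioo (0 : ℝ) 1, ∀ k, ∀ᶠ n in atTop, g k (ψ δ n) ≤ β δ * f n + b δ * e k) :
    ∃ l : ℝ, Tendsto f atTop (𝓝 l) ∧ Tendsto L atTop (𝓝 l) := by
  have hlim (δ) (hδ : δ ∈ Set.Ioo (0 : ℝ) 1) (k) :
      Tendsto (fun n => α δ * g k (φ δ n) + a δ * e k) atTop (𝓝 (α δ * L k + a δ * e k)) :=
    (((hg k).comp (hφ δ hδ)).const_mul _).add_const _
  have hb0 : IsBoundedUnder (· ≥ ·) atTop f := isBoundedUnder_of ⟨0, hf⟩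
  have hb1 : IsBoundedUnder (· ≤ ·) atTop f := by
    have hδ : (1 / 2 : ℝ) ∈ Set.Ioo (0 : ℝ) 1 := by norm_num
    exact (hlim _ hδ 0).isBoundedUnder_le.mono_le (hfg _ hδ 0)
  have hU (δ) (hδ : δ ∈ Set.Ioo (0 : ℝ) 1) (k) :
      limsup f atTop ≤ α δ * L k + a δ * e k := by
    rw [← (hlim δ hδ k).limsup_eq]
    exact limsup_le_limsup (hfg δ hδ k) hb0.isCoboundedUnder_le (hlim δ hδ k).isBoundedUnder_le
  have hl (δ) (hδ : δ ∈ Set.Ioo (0 : ℝ) 1) (hβ0 : 0 < β δ) (k) :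
      L k ≤ β δ * liminf f atTop + b δ * e k := by
    have ht : Tendsto (fun n => (β δ)⁻¹ * (g k (ψ δ n) - b δ * e k)) atTop
        (𝓝 ((β δ)⁻¹ * (L k - b δ * e k))) :=
      (((hg k).comp (hψ δ hδ)).sub_const _).const_mul _
    have : (β δ)⁻¹ * (L k - b δ * e k) ≤ liminf f atTop := by
      rw [← ht.liminf_eq]
      refine liminf_le_liminf ?_ ht.isBoundedUnder_ge hb1.isCoboundedUnder_ge
      filter_upwards [hgf δ hδ k] with n hn
      rw [inv_mul_le_iff₀ hβ0]
      linarith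
    rw [inv_mul_le_iff₀ hβ0] at this
    linarith
  set U := limsup f atTop
  set l := liminf f atTop
  have hlU : l ≤ U := liminf_le_limsup hb1 hb0
  have key (η : ℝ) (hη : 0 < η) : ∀ᶠ k in atTop, U - η < L k ∧ L k < l + η := by
    have h1 : ∀ᶠ δ in 𝓝[>] (0 : ℝ), U - η < (α δ)⁻¹ * U := by
      have : Tendsto (fun δ => (α δ)⁻¹ * U) (𝓝[>] 0) (𝓝 U) := by
        simpa using (hα.inv₀ one_ne_zero).mul_const U
      exact this.eventually (lt_mem_nhds (by linarith))
    have h2 : ∀ᶠ δ in 𝓝[>] (0 : ℝ), β δ * l < l + η := by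
      have : Tendsto (fun δ => β δ * l) (𝓝[>] 0) (𝓝 l) := by
        simpa using hβ.mul_const l
      exact this.eventually (gt_mem_nhds (by linarith))
    obtain ⟨δ, h1, h2, hα0, hβ0, hδ⟩ := (h1.and (h2.and
      ((hα.eventually (lt_mem_nhds one_pos)).and
        ((hβ.eventually (lt_mem_nhds one_pos)).and (Ioo_mem_nhdsGT one_pos))))).exists
    have h3 : ∀ᶠ k in atTop, U - η < (α δ)⁻¹ * (U - a δ * e k) := by
      have : Tendsto (fun k => (α δ)⁻¹ * (U - a δ * e k)) atTop (𝓝 ((α δ)⁻¹ * U)) := by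
        simpa using ((he.const_mul (a δ)).const_sub U).const_mul (α δ)⁻¹
      exact this.eventually (lt_mem_nhds h1)
    have h4 : ∀ᶠ k in atTop, β δ * l + b δ * e k < l + η := by
      have : Tendsto (fun k => β δ * l + b δ * e k) atTop (𝓝 (β δ * l)) := by
        simpa using (he.const_mul (b δ)).const_add (β δ * l)
      exact this.eventually (gt_mem_nhds h2)
    filter_upwards [h3, h4] with k h3 h4
    refine ⟨h3.trans_le ?_, (hl δ hδ hβ0 k).trans_lt h4⟩
    rw [inv_mul_le_iff₀ hα0]
    linarith [hU δ hδ k]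
  have hUl : U = l := by
    refine le_antisymm (le_of_forall_pos_le_add fun η hη => ?_) hlU
    obtain ⟨k, h1, h2⟩ := (key (η / 2) (half_pos hη)).exists
    linarith
  refine ⟨l, tendsto_of_liminf_eq_limsup rfl hUl hb1 hb0, ?_⟩
  rw [Metric.tendsto_nhds]
  intro η hη
  filter_upwards [key η hη] with k hk
  rw [Real.dist_eq, abs_lt]
  constructor <;> linarith [hk.1, hk.2]

/-- If `s` is approximated by the sequences `t k` in the sense of Weyl's inequality, and each
`n ^ q * t k n` converges, then so does `n ^ q * s n`, to the limit of the limits. -/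
theorem exists_tendsto_rpow_mul_of_weyl {q : ℝ} (hq : 0 < q) {s : ℕ → ℝ} {t d : ℕ → ℕ → ℝ}
    {L e : ℕ → ℝ} (hs : ∀ n, 0 ≤ s n) (ht : ∀ k n, 0 ≤ t k n) (hd : ∀ k n, 0 ≤ d k n)
    (hde : ∀ k, ∀ j : ℕ, ((j : ℝ) + 1) ^ q * d k j ≤ e k) (he : Tendsto e atTop (𝓝 0))
    (hst : ∀ k i j, 1 ≤ i → 1 ≤ j → s (i + j) ≤ t k i + d k j)
    (hts : ∀ k i j, 1 ≤ i → 1 ≤ j → t k (i + j) ≤ s i + d k j)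
    (hL : ∀ k, Tendsto (fun n : ℕ => (n : ℝ) ^ q * t k n) atTop (𝓝 (L k))) :
    ∃ l : ℝ, Tendsto (fun n : ℕ => (n : ℝ) ^ q * s n) atTop (𝓝 l) ∧ Tendsto L atTop (𝓝 l) := by
  have hfl (δ : ℝ) (hδ : δ ∈ Set.Ioo (0 : ℝ) 1) :
      Tendsto (fun n : ℕ => ⌊δ * n⌋₊) atTop atTop :=
    tendsto_nat_floor_atTop.comp (tendsto_natCast_atTop_atTop.const_mul_atTop hδ.1)
  have hfle (δ : ℝ) (hδ : δ ∈ Set.Ioo (0 : ℝ) 1) (n : ℕ) : (⌊δ * n⌋₊ : ℝ) ≤ δ * n :=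
    Nat.floor_le (mul_nonneg hδ.1.le n.cast_nonneg)
  have hle (δ : ℝ) (hδ : δ ∈ Set.Ioo (0 : ℝ) 1) (n : ℕ) : ⌊δ * n⌋₊ ≤ n :=
    Nat.floor_le_of_le (mul_le_of_le_one_left n.cast_nonneg hδ.2.le)
  have hφ (δ : ℝ) (hδ : δ ∈ Set.Ioo (0 : ℝ) 1) :
      Tendsto (fun n : ℕ => n - ⌊δ * n⌋₊) atTop atTop := by
    rw [← tendsto_natCast_atTop_iff (R := ℝ)]
    refine tendsto_atTop_mono (fun n => ?_)
      (tendsto_natCast_atTop_atTop.const_mul_atTop (sub_pos.2 hδ.2))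
    rw [Nat.cast_sub (hle δ hδ n)]
    linarith [hfle δ hδ n]
  refine exists_tendsto_of_approx (g := fun k n => (n : ℝ) ^ q * t k n) (e := e)
    (α := fun δ => ((1 - δ)⁻¹) ^ q) (β := fun δ => (1 + δ) ^ q) (a := fun δ => (δ⁻¹) ^ q)
    (b := fun δ => ((1 + δ) / δ) ^ q)
    (φ := fun δ n => n - ⌊δ * n⌋₊) (ψ := fun δ n => n + ⌊δ * n⌋₊)
    (fun n => mul_nonneg (by positivity) (hs n)) hL he ?_ ?_ hφ ?_ ?_ ?_
  · have : ContinuousAt (fun δ : ℝ => ((1 - δ)⁻¹) ^ q) 0 :=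
      ((continuousAt_const.sub continuousAt_id).inv₀ (by simp)).rpow_const (Or.inr hq.le)
    simpa [ContinuousAt] using this.mono_left nhdsWithin_le_nhds
  · have : ContinuousAt (fun δ : ℝ => (1 + δ) ^ q) 0 :=
      (continuousAt_const.add continuousAt_id).rpow_const (Or.inr hq.le)
    simpa [ContinuousAt] using this.mono_left nhdsWithin_le_nhds
  · exact fun δ hδ => tendsto_atTop_mono (fun n => Nat.le_add_right _ _) tendsto_id
  · intro δ hδ k
    filter_upwards [(hfl δ hδ).eventually_ge_atTop 1, (hφ δ hδ).eventually_ge_atTop 1]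
      with n h1 h2
    have h := hst k _ _ h2 h1
    rw [Nat.sub_add_cancel (hle δ hδ n)] at h
    refine rpow_mul_add_le hq.le (ht k) (hd k) (hde k) (inv_nonneg.2 (sub_pos.2 hδ.2).le)
      (inv_nonneg.2 hδ.1.le) h ?_ ?_
    · rw [le_inv_mul_iff₀ (sub_pos.2 hδ.2), Nat.cast_sub (hle δ hδ n)]
      linarith [hfle δ hδ n]
    · rw [le_inv_mul_iff₀ hδ.1]
      exact (Nat.lt_floor_add_one _).le
  · intro δ hδ k
    filter_upwards [(hfl δ hδ).eventually_ge_atTop 1, eventually_ge_atTop 1] with n h1 h2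
    have h0 : 0 ≤ 1 + δ := by linarith [hδ.1]
    refine rpow_mul_add_le hq.le hs (hd k) (hde k) h0 (div_nonneg h0 hδ.1.le)
      (hts k _ _ h2 h1) ?_ ?_
    · push_cast
      linarith [hfle δ hδ n]
    · push_cast
      rw [div_mul_eq_mul_div, le_div_iff₀ hδ.1]
      have := (Nat.lt_floor_add_one (δ * n)).le
      have := mul_le_mul_of_nonneg_left this hδ.1.le
      nlinarith [hfle δ hδ n, hδ.1]

end

/-- A subspace of finite dimension at most `m` is contained in one of dimension exactly `m`,
provided the ambient dimension is at least `m`. -/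
theorem Submodule.exists_ge_finrank_eq {K V : Type*} [Field K] [AddCommGroup V] [Module K V]
    (F : Submodule K V) [FiniteDimensional K F] {m : ℕ} (hF : Module.finrank K F ≤ m)
    (hm : (m : Cardinal) ≤ Module.rank K V) :
    ∃ E : Submodule K V, F ≤ E ∧ FiniteDimensional K E ∧ Module.finrank K E = m := by
  induction m, hF using Nat.le_induction with
  | base => exact ⟨F, le_rfl, inferInstance, rfl⟩
  | succ n hn ih =>
    obtain ⟨E, hFE, hE, rfl⟩ := ih (le_trans (by exact_mod_cast n.le_succ) hm)
    have hlt : Module.rank K E < Module.rank K V := by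
      rw [← Module.finrank_eq_rank]
      exact lt_of_lt_of_le (by exact_mod_cast Nat.lt_succ_self _) hm
    obtain ⟨v, hv⟩ := Submodule.exists_smul_notMem_of_rank_lt hlt
    have hvE : v ∉ E := by simpa using hv 1 one_ne_zero
    refine ⟨E ⊔ K ∙ v, hFE.trans le_sup_left, inferInstance, ?_⟩
    have h := Submodule.finrank_sup_add_finrank_inf_eq E (K ∙ v)
    have hv0 : v ≠ 0 := fun h0 => hvE (h0 ▸ E.zero_mem)
    rw [finrank_span_singleton hv0,
      (Submodule.disjoint_span_singleton_of_notMem hvE).eq_bot, finrank_bot] at h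
    simpa using h

section

variable {H : Type u} [NormedAddCommGroup H] [InnerProductSpace ℂ H]

theorem sv_nonneg (T : H →L[ℂ] H) (j : ℕ) : 0 ≤ sv T j :=
  Real.iInf_nonneg fun _ => Real.iSup_nonneg fun _ => norm_nonneg _

theorem sv_neg (T : H →L[ℂ] H) (j : ℕ) : sv (-T) j = sv T j := by
  simp [sv]

theorem sv_le_of_forall_orthogonal (T : H →L[ℂ] H) {m : ℕ} {c : ℝ} (hc : 0 ≤ c)
    (F : Submodule ℂ H) [FiniteDimensional ℂ F] (hF : Module.finrank ℂ F ≤ m)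
    (h : ∀ ξ ∈ Fᗮ, ‖T ξ‖ ≤ c * ‖ξ‖) : sv T m ≤ c := by
  have hbdd : BddBelow (Set.range fun E : {E : Submodule ℂ H // Module.finrank ℂ E = m} =>
      ⨆ ξ : {ξ : H // ξ ∈ (E.1)ᗮ ∧ ‖ξ‖ = 1}, ‖T ξ.1‖) :=
    ⟨0, by rintro _ ⟨E, rfl⟩; exact Real.iSup_nonneg fun _ => norm_nonneg _⟩
  rcases le_or_gt (m : Cardinal) (Module.rank ℂ H) with hm | hm
  · obtain ⟨E, hFE, -, hE⟩ := F.exists_ge_finrank_eq hF hm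
    refine (ciInf_le hbdd ⟨E, hE⟩).trans (Real.iSup_le (fun ξ => ?_) hc)
    simpa [ξ.2.2] using h ξ.1 (Submodule.orthogonal_le hFE ξ.2.1)
  · have : IsEmpty {E : Submodule ℂ H // Module.finrank ℂ E = m} := by
      refine ⟨fun ⟨E, hE⟩ => ?_⟩
      have : FiniteDimensional ℂ H :=
        Module.rank_lt_aleph0_iff.1 (hm.trans (Cardinal.natCast_lt_aleph0))
      rw [← Module.finrank_eq_rank] at hm
      have := Submodule.finrank_le E
      have : Module.finrank ℂ H < m := by exact_mod_cast hm
      omega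
    rw [sv, Real.iInf_of_isEmpty]
    exact hc

theorem exists_submodule_of_sv_lt (T : H →L[ℂ] H) {j : ℕ} (hj : 1 ≤ j) {c : ℝ}
    (h : sv T j < c) :
    ∃ F : Submodule ℂ H, FiniteDimensional ℂ F ∧ Module.finrank ℂ F ≤ j ∧
      ∀ ξ ∈ Fᗮ, ‖T ξ‖ ≤ c * ‖ξ‖ := by
  by_cases hne : Nonempty {E : Submodule ℂ H // Module.finrank ℂ E = j}
  · obtain ⟨⟨E, hE⟩, hlt⟩ := exists_lt_of_ciInf_lt h
    refine ⟨E, Module.finite_of_finrank_pos (by omega), hE.le, fun ξ hξ => ?_⟩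
    by_cases h0 : ξ = 0
    · simp [h0]
    have hn : ‖ξ‖ ≠ 0 := norm_ne_zero_iff.2 h0
    have hbdd : BddAbove (Set.range fun ξ : {ξ : H // ξ ∈ Eᗮ ∧ ‖ξ‖ = 1} => ‖T ξ.1‖) :=
      ⟨‖T‖, by rintro _ ⟨ξ, rfl⟩; simpa [ξ.2.2] using T.le_opNorm ξ.1⟩
    have := (le_ciSup hbdd ⟨((‖ξ‖⁻¹ : ℝ) : ℂ) • ξ, Eᗮ.smul_mem _ hξ, by
      simp [norm_smul, hn]⟩).trans hlt.le
    simp only [map_smul, norm_smul, Complex.norm_real, norm_inv, norm_norm] at this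
    rwa [inv_mul_le_iff₀ (by positivity), mul_comm] at this
  · have hlt : Module.rank ℂ H < j := by
      by_contra! hle
      obtain ⟨E, -, -, hE⟩ := (⊥ : Submodule ℂ H).exists_ge_finrank_eq (by simp) hle
      exact hne ⟨⟨E, hE⟩⟩
    have : FiniteDimensional ℂ H :=
      Module.rank_lt_aleph0_iff.1 (hlt.trans (Cardinal.natCast_lt_aleph0))
    rw [← Module.finrank_eq_rank] at hlt
    refine ⟨⊤, inferInstance, ?_, ?_⟩
    · rw [finrank_top]; exact_mod_cast hlt.le
    · simp

theorem Submodule.exists_ne_zero_mem_orthogonal_of_finrank_lt (V F : Submodule ℂ H)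
    [FiniteDimensional ℂ V] [FiniteDimensional ℂ F]
    (h : Module.finrank ℂ F < Module.finrank ℂ V) : ∃ ξ ∈ V, ξ ∈ Fᗮ ∧ ξ ≠ 0 := by
  have := LinearMap.ker_ne_bot_of_finrank_lt
    (f := (F.orthogonalProjectionOnto.toLinearMap).comp V.subtype) h
  obtain ⟨ξ, hξ, h0⟩ := Submodule.exists_mem_ne_zero_of_ne_bot this
  refine ⟨ξ, ξ.2, ?_, by simpa using h0⟩
  simpa [Submodule.orthogonalProjectionOnto_eq_zero_iff] using hξ

variable [CompleteSpace H]

theorem ContinuousLinearMap.isCompactOperator_of_sq {P : H →L[ℂ] H} (hP : IsSelfAdjoint P)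
    (h : IsCompactOperator (P ∘L P)) : IsCompactOperator P := by
  have hsq (x : H) : ‖P x‖ ^ 2 ≤ ‖P (P x)‖ * ‖x‖ := by
    rw [← @inner_self_eq_norm_sq ℂ]
    have : inner ℂ (P x) (P x) = inner ℂ (P (P x)) x := (hP.isSymmetric (P x) x).symm
    rw [this]
    exact re_inner_le_norm _ _
  have hcpt := (isCompactOperator_iff_isCompact_closure_image_ball
    (P ∘L P : H →L[ℂ] H).toLinearMap one_pos).1 h
  refine (isCompactOperator_iff_isCompact_closure_image_ball P.toLinearMap one_pos).2 ?_
  refine TotallyBounded.isCompact_of_isClosed (TotallyBounded.closure ?_) isClosed_closure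
  have htb := hcpt.totallyBounded.subset subset_closure
  refine Metric.totallyBounded_iff.2 fun ε hε => ?_
  obtain ⟨t, hts, htf, htc⟩ := Metric.finite_approx_of_totallyBounded htb (ε ^ 2 / 2) (by positivity)
  obtain ⟨s, hs, hsf, htc⟩ := Set.exists_subset_image_finite_and
    (p := fun t => (P ∘L P : H →L[ℂ] H).toLinearMap '' Metric.ball 0 1 ⊆
      ⋃ y ∈ t, Metric.ball y (ε ^ 2 / 2)) |>.1 ⟨t, hts, htf, htc⟩
  refine ⟨P '' s, hsf.image _, ?_⟩
  rintro _ ⟨x, hx, rfl⟩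
  have := htc ⟨x, hx, rfl⟩
  simp only [Set.mem_iUnion, Set.mem_image, exists_prop, Metric.mem_ball] at this ⊢
  obtain ⟨_, ⟨y, hy, rfl⟩, hxy⟩ := this
  refine ⟨P y, ⟨y, hy, rfl⟩, ?_⟩
  have hxn : ‖x‖ < 1 := by simpa using hx
  have hyn : ‖y‖ < 1 := by simpa using hs hy
  have h1 := hsq (x - y)
  have h2 : ‖x - y‖ ≤ 2 := (norm_sub_le _ _).trans (by linarith)
  rw [dist_eq_norm] at hxy ⊢
  have h3 : ‖P (P (x - y))‖ < ε ^ 2 / 2 := by simpa [map_sub] using hxy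
  change ‖P x - P y‖ < ε
  rw [← map_sub]
  refine lt_of_pow_lt_pow_left₀ 2 hε.le ?_
  nlinarith [norm_nonneg (P (P (x - y)))]

/-- The span of the eigenspaces of `P` with eigenvalue larger than `c`. -/
noncomputable def eigenspacesAbove (P : H →L[ℂ] H) (c : ℝ) : Submodule ℂ H :=
  ⨆ μ : {μ : ℝ // c < μ}, Module.End.eigenspace P.toLinearMap (μ : ℂ)

open Module.End

theorem le_re_inner_of_mem_eigenspacesAbove {P : H →L[ℂ] H} (hP : IsSelfAdjoint P) {c : ℝ}
    {x : H} (hx : x ∈ eigenspacesAbove P c) : c * ‖x‖ ^ 2 ≤ (inner ℂ (P x) x).re := by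
  have hort : OrthogonalFamily ℂ
      (fun μ : {μ : ℝ // c < μ} => eigenspace P.toLinearMap (μ : ℂ))
      fun μ => (eigenspace P.toLinearMap (μ : ℂ)).subtypeₗᵢ :=
    hP.isSymmetric.orthogonalFamily_eigenspaces.comp
      (f := fun μ : {μ : ℝ // c < μ} => ((μ : ℝ) : ℂ))
      (Complex.ofReal_injective.comp Subtype.coe_injective)
  obtain ⟨f, hf, rfl⟩ := (Submodule.mem_iSup_iff_exists_finsupp _ _).1 hx
  let g (μ : {μ : ℝ // c < μ}) : eigenspace P.toLinearMap (μ : ℂ) := ⟨f μ, hf μ⟩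
  have hx : (f.sum fun _ v => v) =
      ∑ μ ∈ f.support, (eigenspace P.toLinearMap (μ : ℂ)).subtypeₗᵢ (g μ) := rfl
  have hPx : P (f.sum fun _ v => v) = ∑ μ ∈ f.support,
      (eigenspace P.toLinearMap (μ : ℂ)).subtypeₗᵢ (((μ : ℝ) : ℂ) • g μ) := by
    rw [hx, map_sum]
    exact Finset.sum_congr rfl fun μ _ => mem_eigenspace_iff.1 (hf μ)
  rw [hPx, hx, hort.inner_sum, hort.norm_sum, Finset.mul_sum, Complex.re_sum]
  refine Finset.sum_le_sum fun μ _ => ?_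
  rw [inner_smul_left, Complex.conj_ofReal, Complex.re_ofReal_mul, ← inner_self_eq_norm_sq (𝕜 := ℂ)]
  exact mul_le_mul_of_nonneg_right μ.2.le inner_self_nonneg

theorem norm_apply_le_of_mem_orthogonal_eigenspacesAbove {P : H →L[ℂ] H} (hP : P.IsPositive)
    (hc : IsCompactOperator P) {c : ℝ} (hc0 : 0 ≤ c) {x : H}
    (hx : x ∈ (eigenspacesAbove P c)ᗮ) : ‖P x‖ ≤ c * ‖x‖ := by
  have hinv : ∀ x ∈ (eigenspacesAbove P c)ᗮ, P x ∈ (eigenspacesAbove P c)ᗮ := by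
    intro x hx
    rw [eigenspacesAbove, ← Submodule.iInf_orthogonal] at hx ⊢
    rw [Submodule.mem_iInf] at hx ⊢
    exact fun μ => hP.isSymmetric.invariant_orthogonalComplement_eigenspace _ x (hx μ)
  let S : (eigenspacesAbove P c)ᗮ →L[ℂ] (eigenspacesAbove P c)ᗮ := P.restrict hinv
  have hSc : IsCompactOperator S := hc.restrict' hinv
  have hSs : S.IsSymmetric := hP.isSymmetric.restrict_invariant hinv
  have hev : ∀ μ, HasEigenvalue S.toLinearMap μ → ‖μ‖ ≤ c := by
    intro μ hμ
    obtain ⟨v, hv, hv0⟩ := hμ.exists_hasEigenvector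
    rw [mem_eigenspace_iff] at hv
    have hPv : P v = μ • (v : H) := congrArg Subtype.val hv
    have hre : ((μ.re : ℝ) : ℂ) = μ := Complex.conj_eq_iff_re.1 (hSs.conj_eigenvalue_eq_self hμ)
    have hv0' : (v : H) ≠ 0 := by simpa using hv0
    have hμ0 : 0 ≤ μ.re := by
      have h := hP.re_inner_nonneg_left (v : H)
      rw [hPv, ← hre, inner_smul_left, Complex.conj_ofReal] at h
      simp only [RCLike.re_to_complex, Complex.re_ofReal_mul] at h
      have h' : 0 < (inner ℂ (v : H) (v : H)).re := by
        have := inner_self_eq_norm_sq (𝕜 := ℂ) (v : H)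
        simp only [RCLike.re_to_complex] at this
        rw [this]; positivity
      exact nonneg_of_mul_nonneg_left h h'
    rw [← hre, Complex.norm_real, Real.norm_of_nonneg hμ0]
    by_contra! hlt
    have hmem : (v : H) ∈ eigenspacesAbove P c := by
      refine Submodule.mem_iSup_of_mem ⟨μ.re, hlt⟩ ?_
      rw [mem_eigenspace_iff]
      simpa [hre] using hPv
    exact hv0' (inner_self_eq_zero.1 (v.2 v hmem))
  have hnorm : ‖S‖ ≤ c := by
    have h : (‖S‖₊ : ENNReal) ≤ ENNReal.ofReal c := by
      rw [← S.spectralRadius_eq_nnnorm hSs.isSelfAdjoint, spectralRadius]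
      refine iSup₂_le fun μ hμ => ?_
      by_cases h0 : μ = 0
      · simp [h0]
      have := hev μ ((hSc.hasEigenvalue_iff_mem_spectrum h0).2 hμ)
      rw [← enorm_eq_nnnorm, ← ofReal_norm]
      exact ENNReal.ofReal_le_ofReal this
    rw [← enorm_eq_nnnorm, ← ofReal_norm] at h
    exact (ENNReal.ofReal_le_ofReal_iff hc0).1 h
  exact (S.le_opNorm ⟨x, hx⟩).trans (mul_le_mul_of_nonneg_right hnorm (norm_nonneg _))

theorem IsPosNegDecomp.neg {A P N : H →L[ℂ] H} (h : IsPosNegDecomp A P N) :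
    IsPosNegDecomp (-A) N P := by
  obtain ⟨rfl, hP, hN, hPN⟩ := h
  refine ⟨neg_sub P N, hN, hP, ?_⟩
  have := congrArg ContinuousLinearMap.adjoint hPN
  rwa [ContinuousLinearMap.adjoint_comp, map_zero, hP.isSelfAdjoint.adjoint_eq,
    hN.isSelfAdjoint.adjoint_eq] at this

theorem sv_posPart_le {A P N : H →L[ℂ] H} (hA : IsPosNegDecomp A P N) (hc : IsCompactOperator A)
    {m : ℕ} {c : ℝ} (hc0 : 0 ≤ c) (F : Submodule ℂ H) [FiniteDimensional ℂ F]
    (hF : Module.finrank ℂ F ≤ m)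
    (h : ∀ ξ ∈ Fᗮ, (inner ℂ (A ξ) ξ).re ≤ c * ‖ξ‖ ^ 2) : sv P m ≤ c := by
  have hNP : N ∘L P = 0 := hA.neg.2.2.2
  obtain ⟨rfl, hP, hN, hPN⟩ := hA
  have hPc : IsCompactOperator P := by
    refine ContinuousLinearMap.isCompactOperator_of_sq hP.isSelfAdjoint ?_
    have : P ∘L P = P ∘L (P - N) := by rw [ContinuousLinearMap.comp_sub, hPN, sub_zero]
    rw [this]
    exact hc.clm_comp P
  refine le_of_forall_gt_imp_ge_of_dense fun c' hc' => ?_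
  have hc'0 : 0 < c' := hc0.trans_lt hc'
  set W := eigenspacesAbove P c'
  rcases le_or_gt ((m + 1 : ℕ) : Cardinal) (Module.rank ℂ W) with hW | hW
  · obtain ⟨V, -, hVf, hV⟩ := (⊥ : Submodule ℂ W).exists_ge_finrank_eq (by simp) hW
    have hV' : Module.finrank ℂ (V.map W.subtype) = m + 1 := by
      rw [Submodule.finrank_map_subtype_eq, hV]
    obtain ⟨ξ, hξV, hξF, hξ0⟩ :=
      (V.map W.subtype).exists_ne_zero_mem_orthogonal_of_finrank_lt F (by omega)
    have hξW : ξ ∈ W := Submodule.map_subtype_le _ _ hξV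
    have hNξ : N ξ = 0 := by
      have : W ≤ LinearMap.ker N.toLinearMap := by
        refine iSup_le fun μ x hx => ?_
        have hμ0 : ((μ : ℝ) : ℂ) ≠ 0 := by exact_mod_cast (hc'0.trans μ.2).ne'
        have h1 : N (P x) = 0 := congrArg (fun T : H →L[ℂ] H => T x) hNP
        rw [mem_eigenspace_iff] at hx
        change P x = _ at hx
        rw [hx, map_smul] at h1
        exact (smul_eq_zero.1 h1).resolve_left hμ0
      exact this hξW
    have h1 := h ξ hξF
    have h2 := le_re_inner_of_mem_eigenspacesAbove hP.isSelfAdjoint hξW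
    rw [sub_apply, hNξ, sub_zero] at h1
    have : 0 < ‖ξ‖ ^ 2 := by positivity
    nlinarith
  · have : FiniteDimensional ℂ W :=
      Module.rank_lt_aleph0_iff.1 (hW.trans (Cardinal.natCast_lt_aleph0))
    rw [← Module.finrank_eq_rank] at hW
    have hW' : Module.finrank ℂ W < m + 1 := by exact_mod_cast hW
    exact sv_le_of_forall_orthogonal P hc'0.le W (by omega) fun ξ hξ =>
      norm_apply_le_of_mem_orthogonal_eigenspacesAbove hP hPc hc'0.le hξ

/-- Weyl's inequality for positive parts. -/
theorem sv_posPart_add_le {A P N A' P' N' : H →L[ℂ] H} (hA : IsPosNegDecomp A P N)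
    (hc : IsCompactOperator A) (hA' : IsPosNegDecomp A' P' N') {i j : ℕ} (hi : 1 ≤ i)
    (hj : 1 ≤ j) : sv P (i + j) ≤ sv P' i + sv (A - A') j := by
  refine le_of_forall_pos_le_add fun ε hε => ?_
  obtain ⟨E, hEf, hE, hEb⟩ :=
    exists_submodule_of_sv_lt P' hi (lt_add_of_pos_right (sv P' i) (half_pos hε))
  obtain ⟨F, hFf, hF, hFb⟩ :=
    exists_submodule_of_sv_lt (A - A') hj (lt_add_of_pos_right (sv (A - A') j) (half_pos hε))
  have h1 := sv_nonneg P' i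
  have h2 := sv_nonneg (A - A') j
  refine sv_posPart_le hA hc (by positivity) (E ⊔ F)
    ((Submodule.finrank_add_le_finrank_add_finrank E F).trans (add_le_add hE hF)) fun ξ hξ => ?_
  have hbE := hEb ξ (Submodule.orthogonal_le le_sup_left hξ)
  have hbF := hFb ξ (Submodule.orthogonal_le le_sup_right hξ)
  have hsum : A ξ = (P' ξ - N' ξ) + (A - A') ξ := by
    rw [← sub_apply, ← hA'.1, sub_apply]; abel
  have hN := hA'.2.2.1.re_inner_nonneg_left ξ
  have hPi := re_inner_le_norm (𝕜 := ℂ) (P' ξ) ξ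
  have hDi := re_inner_le_norm (𝕜 := ℂ) ((A - A') ξ) ξ
  simp only [RCLike.re_to_complex] at hN hPi hDi
  rw [hsum, inner_add_left, inner_sub_left, Complex.add_re, Complex.sub_re]
  have := mul_le_mul_of_nonneg_right hbE (norm_nonneg ξ)
  have := mul_le_mul_of_nonneg_right hbF (norm_nonneg ξ)
  nlinarith

theorem exists_tendsto_sv_posPart {p : ℝ} (hp : 0 < p) {A P N : ℕ → H →L[ℂ] H}
    (hc : ∀ k, IsCompactOperator (A k)) (hdec : ∀ k, IsPosNegDecomp (A k) (P k) (N k))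
    {L : ℕ → ℝ}
    (hL : ∀ k, Tendsto (fun j : ℕ => (j : ℝ) ^ (1 / p) * sv (P k) j) atTop (nhds (L k)))
    {A₀ P₀ N₀ : H →L[ℂ] H} (hc₀ : IsCompactOperator A₀) {e : ℕ → ℝ}
    (hde : ∀ k, ∀ j : ℕ, ((j : ℝ) + 1) ^ (1 / p) * sv (A k - A₀) j ≤ e k)
    (he : Tendsto e atTop (nhds 0)) (hdec₀ : IsPosNegDecomp A₀ P₀ N₀) :
    ∃ l : ℝ, Tendsto (fun j : ℕ => (j : ℝ) ^ (1 / p) * sv P₀ j) atTop (nhds l) ∧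
      Tendsto L atTop (nhds l) := by
  refine exists_tendsto_rpow_mul_of_weyl (t := fun k => sv (P k)) (d := fun k => sv (A k - A₀))
    (one_div_pos.2 hp) (sv_nonneg _) (fun k => sv_nonneg _) (fun k => sv_nonneg _) hde he
    (fun k i j hi hj => ?_) (fun k i j hi hj => sv_posPart_add_le (hdec k) (hc k) hdec₀ hi hj) hL
  rw [← sv_neg (A k - A₀), neg_sub]
  exact sv_posPart_add_le hdec₀ hc₀ (hdec k) hi hj

end

/-- If self-adjoint `A_k ∈ 𝓛_{p,∞}` have existing limits `Λ^±(A_k) = lim_j j^{1/p} λ_j^±(A_k)`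
and `‖A_k - A‖_{p,∞} → 0` with `A` self-adjoint, then `Λ^±(A) = lim_j j^{1/p} λ_j^±(A)` exist
and `Λ^±(A_k) → Λ^±(A)`. -/
theorem weylLimits_closed {H : Type u} [NormedAddCommGroup H] [InnerProductSpace ℂ H]
    [CompleteSpace H] (p : ℝ) (hp : 0 < p)
    (A : ℕ → H →L[ℂ] H) (P N : ℕ → H →L[ℂ] H)
    (hsa : ∀ k, IsSelfAdjoint (A k))
    (hmem : ∀ k, MemWeak p (A k))
    (hdec : ∀ k, IsPosNegDecomp (A k) (P k) (N k))
    (Lplus Lminus : ℕ → ℝ)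
    (hLp : ∀ k, Tendsto (fun j : ℕ => (j : ℝ) ^ (1 / p) * sv (P k) j) atTop (nhds (Lplus k)))
    (hLm : ∀ k, Tendsto (fun j : ℕ => (j : ℝ) ^ (1 / p) * sv (N k) j) atTop (nhds (Lminus k)))
    (A₀ : H →L[ℂ] H) (hA₀ : IsSelfAdjoint A₀)
    (hdiff : ∀ k, MemWeak p (A k - A₀))
    (hconv : Tendsto (fun k => weakNorm p (A k - A₀)) atTop (nhds 0))
    (P₀ N₀ : H →L[ℂ] H) (hdec₀ : IsPosNegDecomp A₀ P₀ N₀) :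
    ∃ LP LM : ℝ,
      Tendsto (fun j : ℕ => (j : ℝ) ^ (1 / p) * sv P₀ j) atTop (nhds LP) ∧
      Tendsto (fun j : ℕ => (j : ℝ) ^ (1 / p) * sv N₀ j) atTop (nhds LM) ∧
      Tendsto Lplus atTop (nhds LP) ∧ Tendsto Lminus atTop (nhds LM) := by
  have hc₀ : IsCompactOperator A₀ := by
    simpa [sub_sub_cancel] using (hmem 0).1.sub (hdiff 0).1
  have hde : ∀ k, ∀ j : ℕ, ((j : ℝ) + 1) ^ (1 / p) * sv (A k - A₀) j ≤ weakNorm p (A k - A₀) := by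
    intro k j
    obtain ⟨-, C, hC⟩ := hdiff k
    exact le_ciSup (f := fun j : ℕ => ((j : ℝ) + 1) ^ (1 / p) * sv (A k - A₀) j)
      ⟨C, Set.forall_mem_range.2 hC⟩ j
  obtain ⟨LP, hP₀, hLP⟩ :=
    exists_tendsto_sv_posPart hp (fun k => (hmem k).1) hdec hLp hc₀ hde hconv hdec₀
  obtain ⟨LM, hN₀, hLM⟩ := exists_tendsto_sv_posPart (A := fun k => -A k) (A₀ := -A₀) hp
    (fun k => (hmem k).1.neg) (fun k => (hdec k).neg) hLm hc₀.neg
    (fun k j => by rw [← neg_sub', sv_neg]; exact hde k j) hconv hdec₀.neg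
  exact ⟨LP, LM, hP₀, hN₀, hLP, hLM⟩
end

section
/- Let A and B be operators in 𝓛_{1,∞} on a separable complex Hilbert space, and let (λ_j(A))_{j≥0}, (λ_j(B))_{j≥0}, (λ_j(A+B))_{j≥0} be eigenvalue sequences of A, B and A+B respectively. Then sup_{N≥1} | ∑_{j<N} λ_j(A+B) − ∑_{j<N} λ_j(A) − ∑_{j<N} λ_j(B) | < ∞. -/
open Filter MeasureTheory

universe u v

/-- `lam` is an eigenvalue sequence of `A`: the moduli `‖lam j‖` are nonincreasing and every
nonzero `z ∈ ℂ` occurs in `lam` exactly `algMult A z` times (so the nonzero eigenvalues are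
listed with algebraic multiplicity in order of decreasing modulus, padded with zeros). -/
def IsEigenvalueSequence {H : Type u} [NormedAddCommGroup H] [InnerProductSpace ℂ H]
    (A : H →L[ℂ] H) (lam : ℕ → ℂ) : Prop :=
  (∀ j, ‖lam (j + 1)‖ ≤ ‖lam j‖) ∧
  ∀ z : ℂ, z ≠ 0 →
    Cardinal.lift.{u} (Cardinal.mk {j : ℕ // lam j = z}) = Cardinal.lift.{0} (algMult A z)

/-- For every `k`, the operator `T` is bounded by `c / (k + 1)` on the orthogonal complement of
some subspace of dimension at most `k`. -/
def RankApprox {H : Type u} [NormedAddCommGroup H] [InnerProductSpace ℂ H]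
    (T : H →L[ℂ] H) (c : ℝ) : Prop :=
  ∀ k : ℕ, ∃ E : Submodule ℂ H, FiniteDimensional ℂ E ∧ Module.finrank ℂ E ≤ k ∧
    ∀ x ∈ Eᗮ, ‖T x‖ ≤ c / (k + 1) * ‖x‖

/-- The compression of `T` to the subspace `W`. -/
noncomputable def compress {H : Type u} [NormedAddCommGroup H] [InnerProductSpace ℂ H]
    (W : Submodule ℂ H) [W.HasOrthogonalProjection] (T : H →L[ℂ] H) : W →ₗ[ℂ] W :=
  (W.orthogonalProjectionOnto ∘L T ∘L W.subtypeL : W →L[ℂ] W)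

section Hadamard

variable {V : Type*} [NormedAddCommGroup V] [InnerProductSpace ℂ V]

theorem norm_basis_det_le {n : ℕ} (b : OrthonormalBasis (Fin n) ℂ V) (f : Fin n → V) :
    ‖b.toBasis.det f‖ ≤ ∏ i, ‖f i‖ := by
  have : FiniteDimensional ℂ V := b.toBasis.finiteDimensional_of_finite
  have hd : Module.finrank ℂ V = Fintype.card (Fin n) := Module.finrank_eq_card_basis b.toBasis
  let g := InnerProductSpace.gramSchmidtOrthonormalBasis hd f
  have h1 : b.toBasis.det = b.toBasis.det g • g.toBasis.det := by
    simpa using AlternatingMap.eq_smul_basis_det g.toBasis b.toBasis.det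
  rw [h1, AlternatingMap.smul_apply, norm_smul,
    InnerProductSpace.gramSchmidtOrthonormalBasis_det hd f]
  have h2 : ‖b.toBasis.det g‖ = 1 := b.det_to_matrix_orthonormalBasis g
  rw [h2, one_mul, norm_prod]
  refine Finset.prod_le_prod (fun _ _ => norm_nonneg _) fun i _ => ?_
  have := norm_inner_le_norm (𝕜 := ℂ) (g i) (f i)
  rwa [g.orthonormal.1 i, one_mul] at this

theorem norm_det_le_prod {n : ℕ} (b : OrthonormalBasis (Fin n) ℂ V) (T : V →ₗ[ℂ] V) :
    ‖LinearMap.det T‖ ≤ ∏ i, ‖T (b i)‖ := by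
  have h := b.toBasis.det_comp T b
  have h3 : b.toBasis.det b = 1 := by simpa using b.toBasis.det_self
  rw [h3, mul_one] at h
  rw [← h]
  exact norm_basis_det_le b _

end Hadamard

section Approx

variable {H : Type u} [NormedAddCommGroup H] [InnerProductSpace ℂ H]

theorem RankApprox.exists_orthonormal {T : H →L[ℂ] H} {c : ℝ} (hT : RankApprox T c) (n : ℕ) :
    ∀ V : Submodule ℂ H, FiniteDimensional ℂ V → Module.finrank ℂ V = n →
    ∃ e : Fin n → H, Orthonormal ℂ e ∧ (∀ i, e i ∈ V) ∧ ∀ i, ‖T (e i)‖ ≤ c / (i + 1) := by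
  induction n with
  | zero => exact fun V _ _ => ⟨fun i => i.elim0, by simp [Orthonormal], by simp, by simp⟩
  | succ n ih =>
    intro V hV hd
    obtain ⟨E, hE, hEk, hEb⟩ := hT n
    obtain ⟨v, hvV, hvE, hv⟩ : ∃ v ∈ V, v ∈ Eᗮ ∧ ‖v‖ = 1 := by
      have hlt : Module.finrank ℂ E < Module.finrank ℂ V := by omega
      have hker := LinearMap.ker_ne_bot_of_finrank_lt
        (f := ((E.orthogonalProjectionOnto ∘L V.subtypeL : V →L[ℂ] E) : V →ₗ[ℂ] E)) hlt
      obtain ⟨w, hw, hw0⟩ := Submodule.exists_mem_ne_zero_of_ne_bot hker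
      have hw1 : (w : H) ∈ Eᗮ := by
        rw [← Submodule.orthogonalProjectionOnto_eq_zero_iff]
        simpa using hw
      have hw2 : (w : H) ≠ 0 := by simpa using hw0
      exact ⟨((‖(w : H)‖ : ℂ)⁻¹) • (w : H), V.smul_mem _ w.2, Submodule.smul_mem _ _ hw1,
        norm_smul_inv_norm hw2⟩
    let v' : V := ⟨v, hvV⟩
    have hv_ne : v' ≠ 0 := by
      intro h
      have : v = 0 := congrArg Subtype.val h
      simp [this] at hv
    have : Fact (Module.finrank ℂ V = n + 1) := ⟨hd⟩
    have hfr : Module.finrank ℂ (ℂ ∙ v')ᗮ = n := Submodule.finrank_orthogonal_span_singleton hv_ne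
    obtain ⟨e, he1, he2, he3⟩ := ih ((ℂ ∙ v')ᗮ.map V.subtype) inferInstance
      (by rw [Submodule.finrank_map_subtype_eq]; exact hfr)
    have hperp : ∀ i, inner ℂ v (e i) = 0 := by
      intro i
      obtain ⟨w, hw, hwe⟩ := he2 i
      rw [← hwe]
      exact (Submodule.mem_orthogonal_singleton_iff_inner_right (u := v') (v := w)).1 hw
    refine ⟨Fin.snoc e v, ?_, ?_, ?_⟩
    · rw [orthonormal_iff_ite] at he1 ⊢
      intro i j
      refine Fin.lastCases ?_ (fun i => ?_) i <;> refine Fin.lastCases ?_ (fun j => ?_) j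
      · simp [inner_self_eq_norm_sq_to_K, hv]
      · simp [hperp, (Fin.castSucc_lt_last j).ne']
      · simp [inner_eq_zero_symm.1 (hperp i), (Fin.castSucc_lt_last i).ne]
      · simp [he1]
    · refine Fin.lastCases (by simpa using hvV) fun i => ?_
      obtain ⟨w, -, hwe⟩ := he2 i
      simp [← hwe]
    · refine Fin.lastCases ?_ fun i => ?_
      · have := hEb v hvE
        rw [hv, mul_one] at this
        simpa using this
      · simpa using he3 i

theorem RankApprox.exists_orthonormalBasis {T : H →L[ℂ] H} {c : ℝ} (hT : RankApprox T c)
    (V : Submodule ℂ H) [FiniteDimensional ℂ V] :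
    ∃ b : OrthonormalBasis (Fin (Module.finrank ℂ V)) ℂ V, ∀ i, ‖T (b i)‖ ≤ c / (i + 1) := by
  obtain ⟨e, he1, he2, he3⟩ := hT.exists_orthonormal _ V inferInstance rfl
  let f : Fin (Module.finrank ℂ V) → V := fun i => ⟨e i, he2 i⟩
  have hf : Orthonormal ℂ f := by
    rw [← V.subtypeₗᵢ.orthonormal_comp_iff]
    exact he1
  have hspan : Submodule.span ℂ (Set.range f) = ⊤ :=
    hf.linearIndependent.span_eq_top_of_card_eq_finrank' (by simp)
  exact ⟨OrthonormalBasis.mk hf hspan.ge, fun i => by simpa [f] using he3 i⟩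

theorem norm_compress_le (W : Submodule ℂ H) [FiniteDimensional ℂ W] (T : H →L[ℂ] H) (x : W) :
    ‖compress W T x‖ ≤ ‖T x‖ :=
  W.norm_orthogonalProjectionOnto_apply_le (T x)

theorem compress_of_mem {W : Submodule ℂ H} [FiniteDimensional ℂ W] {T : H →L[ℂ] H} {x : W}
    (h : T x ∈ W) : (compress W T x : H) = T x :=
  congrArg Subtype.val (Submodule.orthogonalProjectionOnto_mem_subspace_eq_self (⟨T x, h⟩ : W))

theorem inner_compress (W : Submodule ℂ H) [FiniteDimensional ℂ W] (T : H →L[ℂ] H) (x y : W) :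
    inner ℂ x (compress W T y) = inner ℂ (x : H) (T y) :=
  Submodule.inner_orthogonalProjectionOnto_eq_of_mem_left x (T y)

/-- An invariant subspace on which the operator has no eigenvalue of modulus less than `t`. -/
def IsOuterInvariant (T : H →L[ℂ] H) (t : ℝ) (V : Submodule ℂ H) : Prop :=
  (∀ x ∈ V, T x ∈ V) ∧ ∀ x ∈ V, ∀ z : ℂ, ‖z‖ < t → T x = z • x → x = 0

theorem IsOuterInvariant.le_norm_of_mem_roots {T : H →L[ℂ] H} {t : ℝ} {V : Submodule ℂ H}
    [FiniteDimensional ℂ V] (hV : IsOuterInvariant T t V) {z : ℂ}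
    (hz : z ∈ (compress V T).charpoly.roots) : t ≤ ‖z‖ := by
  by_contra! hlt
  rw [Polynomial.mem_roots (compress V T).charpoly_monic.ne_zero,
    ← Module.End.hasEigenvalue_iff_isRoot_charpoly] at hz
  obtain ⟨x, hx⟩ := hz.exists_hasEigenvector
  have h1 : T x = z • (x : H) := by
    rw [← compress_of_mem (hV.1 x x.2), hx.apply_eq_smul]; rfl
  exact hx.2 (Subtype.ext (hV.2 x x.2 z hlt h1))

theorem IsOuterInvariant.finrank_le {T : H →L[ℂ] H} {c : ℝ} (hc : 0 < c) (hT : RankApprox T c)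
    {N : ℕ} (hN : 1 ≤ N) {V : Submodule ℂ H} [FiniteDimensional ℂ V]
    (hV : IsOuterInvariant T (3 * c / N) V) : Module.finrank ℂ V ≤ N := by
  by_contra! hlt
  set n := Module.finrank ℂ V with hn
  obtain ⟨b, hb⟩ := hT.exists_orthonormalBasis V
  have hN' : (0 : ℝ) < N := by exact_mod_cast hN
  have hupper : ‖LinearMap.det (compress V T)‖ ≤ c ^ n / n.factorial := by
    calc ‖LinearMap.det (compress V T)‖ ≤ ∏ i, ‖compress V T (b i)‖ := norm_det_le_prod b _
      _ ≤ ∏ i : Fin n, c / ((i : ℕ) + 1 : ℝ) := Finset.prod_le_prod (fun _ _ => norm_nonneg _)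
          fun i _ => (norm_compress_le V T _).trans (hb i)
      _ = ∏ i ∈ Finset.range n, c / ((i : ℕ) + 1 : ℝ) :=
          Fin.prod_univ_eq_prod_range (fun i : ℕ => c / (i + 1 : ℝ)) n
      _ = c ^ n / n.factorial := by
          rw [Finset.prod_div_distrib, Finset.prod_const, Finset.card_range,
            ← Finset.prod_range_add_one_eq_factorial]
          push_cast
          rfl
  have hlower : (3 * c / N) ^ n ≤ ‖LinearMap.det (compress V T)‖ := by
    have hs := IsAlgClosed.splits (compress V T).charpoly
    have hcard : (compress V T).charpoly.roots.card = n := by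
      rw [← hs.natDegree_eq_card_roots, LinearMap.charpoly_natDegree]
    rw [Module.End.det_eq_prod_roots_charpoly_of_splits hs, ← hcard,
      ← Multiset.card_map (fun z : ℂ => ‖z‖)]
    have : ‖(compress V T).charpoly.roots.prod‖
        = ((compress V T).charpoly.roots.map (fun z : ℂ => ‖z‖)).prod :=
      map_multiset_prod (normHom : ℂ →*₀ ℝ) _
    rw [this]
    have h0 : (0 : ℝ) ≤ 3 * c / N := by positivity
    have hall : ∀ z ∈ (compress V T).charpoly.roots, 3 * c / N ≤ ‖z‖ :=
      fun z hz => hV.le_norm_of_mem_roots hz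
    generalize (compress V T).charpoly.roots = m at hall
    induction m using Multiset.induction with
    | empty => simp
    | cons a s ih =>
      simp only [Multiset.map_cons, Multiset.card_cons, Multiset.prod_cons, pow_succ']
      exact mul_le_mul (hall a (by simp)) (ih fun z hz => hall z (by simp [hz]))
        (pow_nonneg h0 _) (norm_nonneg _)
  have h1 : (n : ℝ) ^ n / n.factorial ≤ Real.exp n := Real.pow_div_factorial_le_exp (n : ℝ) (by positivity) n
  have h2 : Real.exp n < 3 ^ n := by
    rw [← Real.exp_one_pow]
    exact pow_lt_pow_left₀ (Real.exp_one_lt_d9.trans (by norm_num)) (Real.exp_pos 1).le (by omega)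
  have h3 := hlower.trans hupper
  have hfac : (0 : ℝ) < n.factorial := by positivity
  rw [div_pow, mul_pow, div_le_div_iff₀ (by positivity) hfac] at h3
  rw [div_le_iff₀ hfac] at h1
  have h4 : (N : ℝ) ^ n ≤ (n : ℝ) ^ n := by gcongr
  have h5 : (3 : ℝ) ^ n * n.factorial ≤ (N : ℝ) ^ n := by
    have hcn : 0 < c ^ n := by positivity
    nlinarith
  nlinarith

theorem norm_sub_starProjection_le (V : Submodule ℂ H) [FiniteDimensional ℂ V] (x : H) :
    ‖x - V.starProjection x‖ ≤ ‖x‖ := by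
  rw [← Submodule.starProjection_orthogonal_val]
  exact Vᗮ.norm_starProjection_apply_le x

end Approx

section Spectral

variable {H : Type u} [NormedAddCommGroup H] [InnerProductSpace ℂ H]

theorem RankApprox.exists_maximal_outerInvariant {T : H →L[ℂ] H} {c : ℝ} (hc : 0 < c)
    (hT : RankApprox T c) {N : ℕ} (hN : 1 ≤ N) :
    ∃ V : Submodule ℂ H, FiniteDimensional ℂ V ∧ IsOuterInvariant T (3 * c / N) V ∧
      ∀ z : ℂ, 3 * c / N ≤ ‖z‖ → ∀ x, T x - z • x ∈ V → x ∈ V := by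
  by_contra! hcon
  have key : ∀ n : ℕ, ∃ V : Submodule ℂ H, FiniteDimensional ℂ V ∧
      IsOuterInvariant T (3 * c / N) V ∧ n ≤ Module.finrank ℂ V := by
    intro n
    induction n with
    | zero => exact ⟨⊥, inferInstance, ⟨by simp, by simp⟩, zero_le⟩
    | succ n ih =>
      obtain ⟨V, hV, hVo, hn⟩ := ih
      obtain ⟨z, hz, x, hxV, hx⟩ := hcon V hV hVo
      refine ⟨V ⊔ ℂ ∙ x, inferInstance, ⟨?_, ?_⟩, ?_⟩
      · intro y hy
        obtain ⟨v, hv, w, hw, rfl⟩ := Submodule.mem_sup.1 hy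
        obtain ⟨a, rfl⟩ := Submodule.mem_span_singleton.1 hw
        have : T (v + a • x) = (T v + a • (T x - z • x)) + (a * z) • x := by
          rw [map_add, map_smul]; module
        rw [this]
        exact Submodule.add_mem_sup (V.add_mem (hVo.1 v hv) (V.smul_mem _ hxV))
          (Submodule.smul_mem _ _ (Submodule.mem_span_singleton_self x))
      · intro y hy μ hμ hTy
        obtain ⟨v, hv, w, hw, rfl⟩ := Submodule.mem_sup.1 hy
        obtain ⟨a, rfl⟩ := Submodule.mem_span_singleton.1 hw
        have h1 : (a * (μ - z)) • x = T v + a • (T x - z • x) - μ • v := by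
          have : (a * (μ - z)) • x = μ • (v + a • x) - μ • v - (a * z) • x := by module
          rw [this, ← hTy, map_add, map_smul]; module
        have h2 : (a * (μ - z)) • x ∈ V := by
          rw [h1]
          exact V.sub_mem (V.add_mem (hVo.1 v hv) (V.smul_mem _ hxV)) (V.smul_mem _ hv)
        have h3 : a * (μ - z) = 0 := by
          by_contra h0
          exact hx ((V.smul_mem_iff h0).1 h2)
        have h4 : μ - z ≠ 0 := by
          rw [sub_ne_zero]
          rintro rfl
          exact absurd hμ hz.not_gt
        have ha : a = 0 := (mul_eq_zero.1 h3).resolve_right h4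
        subst ha
        simp only [zero_smul, add_zero] at hTy ⊢
        exact hVo.2 v hv μ hμ hTy
      · have hlt : V < V ⊔ ℂ ∙ x := by
          refine lt_of_le_of_ne le_sup_left fun h => hx ?_
          rw [h]
          exact Submodule.mem_sup_right (Submodule.mem_span_singleton_self x)
        have := Submodule.finrank_lt_finrank_of_lt hlt
        omega
  obtain ⟨V, hV, hVo, hn⟩ := key (N + 1)
  have := hVo.finrank_le hc hT hN
  omega

theorem coe_compress_sub_pow {T : H →L[ℂ] H} {V : Submodule ℂ H} [FiniteDimensional ℂ V]
    (hV : ∀ x ∈ V, T x ∈ V) (z : ℂ) (k : ℕ) (x : V) :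
    (((compress V T - z • LinearMap.id : Module.End ℂ V) ^ k) x : H)
      = (((T : H →ₗ[ℂ] H) - z • LinearMap.id : Module.End ℂ H) ^ k) (x : H) := by
  induction k generalizing x with
  | zero => simp
  | succ k ih =>
    rw [pow_succ, pow_succ, Module.End.mul_apply, Module.End.mul_apply, ih]
    congr 1
    simp [compress_of_mem (hV x x.2)]

theorem algMult_eq_count_roots {T : H →L[ℂ] H} {V : Submodule ℂ H} [FiniteDimensional ℂ V]
    (hV : ∀ x ∈ V, T x ∈ V) {z : ℂ} (hz : ∀ x, T x - z • x ∈ V → x ∈ V) :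
    algMult T z = ((compress V T).charpoly.roots.count z : ℕ) := by
  have hmem : ∀ (k : ℕ) (x : H), (((T : H →ₗ[ℂ] H) - z • LinearMap.id : Module.End ℂ H) ^ k) x = 0 → x ∈ V := by
    intro k
    induction k with
    | zero => intro x hx; simp at hx; simp [hx]
    | succ k ih =>
      intro x hx
      rw [pow_succ, Module.End.mul_apply] at hx
      exact hz x (by simpa using ih _ hx)
  have hsup : (⨆ ℓ : ℕ, LinearMap.ker (((T : H →ₗ[ℂ] H) - z • LinearMap.id) ^ ℓ))
      = (Module.End.maxGenEigenspace (compress V T) z).map V.subtype := by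
    have h1 : (⨆ ℓ : ℕ, LinearMap.ker (((T : H →ₗ[ℂ] H) - z • LinearMap.id) ^ ℓ))
        = Module.End.maxGenEigenspace (T : H →ₗ[ℂ] H) z := by
      rw [← Module.End.iSup_genEigenspace_eq]
      exact iSup_congr fun k => Module.End.genEigenspace_nat.symm
    rw [h1]
    ext x
    rw [Submodule.mem_map]
    constructor
    · intro hx
      obtain ⟨k, hk⟩ := (Module.End.mem_maxGenEigenspace _ _ _).1 hx
      refine ⟨⟨x, hmem k x hk⟩, (Module.End.mem_maxGenEigenspace _ _ _).2 ⟨k, ?_⟩, rfl⟩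
      exact Subtype.ext ((coe_compress_sub_pow hV z k _).trans hk)
    · rintro ⟨y, hy, rfl⟩
      obtain ⟨k, hk⟩ := (Module.End.mem_maxGenEigenspace _ _ _).1 hy
      refine (Module.End.mem_maxGenEigenspace _ _ _).2 ⟨k, ?_⟩
      exact (coe_compress_sub_pow hV z k y).symm.trans (congrArg Subtype.val hk)
  rw [algMult, hsup, Polynomial.count_roots, ← LinearMap.finrank_maxGenEigenspace_eq,
    ← Submodule.finrank_map_subtype_eq V, Module.finrank_eq_rank]

theorem norm_trace_compress_sub_sum_le {T : H →L[ℂ] H} {V : Submodule ℂ H}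
    [FiniteDimensional ℂ V] {t : ℝ} (ht : 0 < t) (hV : IsOuterInvariant T t V)
    (hmax : ∀ z : ℂ, t ≤ ‖z‖ → ∀ x, T x - z • x ∈ V → x ∈ V) {N : ℕ}
    (hN : Module.finrank ℂ V ≤ N) {lam : ℕ → ℂ} (hlam : IsEigenvalueSequence T lam) :
    ‖LinearMap.trace ℂ V (compress V T) - ∑ j ∈ Finset.range N, lam j‖ ≤ N * t := by
  classical
  have hanti : Antitone fun j => ‖lam j‖ := antitone_nat_of_succ_le hlam.1
  set m := (compress V T).charpoly.roots with hm
  have hs := IsAlgClosed.splits (compress V T).charpoly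
  have hmcard : m.card = Module.finrank ℂ V := by
    rw [hm, ← hs.natDegree_eq_card_roots, LinearMap.charpoly_natDegree]
  have hfib : ∀ z : ℂ, t ≤ ‖z‖ → Cardinal.mk {j : ℕ // lam j = z} = (m.count z : ℕ) := by
    intro z hz
    have h := hlam.2 z (norm_pos_iff.1 (ht.trans_le hz))
    rw [algMult_eq_count_roots hV.1 (hmax z hz)] at h
    simpa [hm] using h
  have hfin : ∀ z : ℂ, t ≤ ‖z‖ → {j : ℕ | lam j = z}.Finite := by
    intro z hz
    have : Cardinal.mk {j : ℕ // lam j = z} < Cardinal.aleph0 := by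
      rw [hfib z hz]; exact Cardinal.natCast_lt_aleph0
    exact Cardinal.lt_aleph0_iff_set_finite.1 this
  have hJ : {j : ℕ | t ≤ ‖lam j‖}.Finite := by
    refine ((m.toFinset.filter fun z => t ≤ ‖z‖).finite_toSet.biUnion
      (t := fun z => {j | lam j = z}) fun z hz => hfin z (Finset.mem_filter.1 hz).2).subset ?_
    intro j hj
    simp only [Set.mem_iUnion, Set.mem_ofPred_eq]
    refine ⟨lam j, ?_, rfl⟩
    simp only [Finset.coe_filter, Set.mem_ofPred_eq, Multiset.mem_toFinset]
    refine ⟨?_, hj⟩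
    rw [← Multiset.one_le_count_iff_mem, Nat.one_le_iff_ne_zero]
    intro h0
    have := hfib (lam j) hj
    rw [h0, Nat.cast_zero, Cardinal.mk_eq_zero_iff] at this
    exact this.false ⟨j, rfl⟩
  set J := hJ.toFinset with hJdef
  have hJmem : ∀ j, j ∈ J ↔ t ≤ ‖lam j‖ := fun j => by simp [hJdef]
  have hroots : m = J.val.map lam := by
    ext z
    rw [Multiset.count_map]
    by_cases hz : t ≤ ‖z‖
    · have h1 : (Cardinal.mk {j : ℕ // lam j = z}) = ((J.filter fun j => z = lam j).card : ℕ) := by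
        rw [← Cardinal.mk_coe_finset]
        refine Cardinal.mk_congr (Equiv.subtypeEquivRight fun j => ?_)
        rw [Finset.mem_filter, hJmem]
        constructor
        · rintro rfl; exact ⟨hz, rfl⟩
        · exact fun h => h.2.symm
      rw [hfib z hz] at h1
      have := Nat.cast_injective h1
      rw [this]
      rfl
    · rw [Multiset.count_eq_zero.2 fun h => hz (hV.le_norm_of_mem_roots h), eq_comm,
        Multiset.card_eq_zero, Multiset.filter_eq_nil]
      rintro j hj rfl
      exact hz ((hJmem j).1 hj)
  have hJcard : J.card ≤ N := by
    rw [← Finset.card_val, ← Multiset.card_map lam, ← hroots, hmcard]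
    exact hN
  have hJsub : J ⊆ Finset.range N := by
    intro j hj
    have hsub : Finset.range (j + 1) ⊆ J := by
      intro i hi
      rw [hJmem] at hj ⊢
      exact hj.trans (hanti (Nat.lt_succ_iff.1 (Finset.mem_range.1 hi)))
    have := Finset.card_le_card hsub
    rw [Finset.card_range] at this
    exact Finset.mem_range.2 (by omega)
  have htr : LinearMap.trace ℂ V (compress V T) = ∑ j ∈ J, lam j := by
    rw [Module.End.trace_eq_sum_roots_charpoly_of_splits hs, ← hm, hroots]
    rfl
  rw [htr, ← Finset.sum_sdiff hJsub, sub_add_cancel_right, norm_neg]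
  calc ‖∑ j ∈ Finset.range N \ J, lam j‖ ≤ ∑ j ∈ Finset.range N \ J, t :=
        norm_sum_le_of_le _ fun j hj => by
          have := (Finset.mem_sdiff.1 hj).2
          rw [hJmem] at this
          exact (not_le.1 this).le
    _ ≤ N * t := by
        rw [Finset.sum_const, nsmul_eq_mul]
        gcongr
        exact (Finset.card_le_card Finset.sdiff_subset).trans (Finset.card_range N).le

end Spectral

section Determinant

theorem differentiable_matrix_det {n : ℕ} :
    Differentiable ℂ fun M : Fin n → Fin n → ℂ => Matrix.det (Matrix.of M) := by
  simp only [Matrix.det_apply', Matrix.of_apply]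
  fun_prop

theorem hasDerivAt_det_of_eq_one {n : ℕ} {M : ℂ → Matrix (Fin n) (Fin n) ℂ}
    {M' : Matrix (Fin n) (Fin n) ℂ} (h0 : M 0 = 1)
    (hM : ∀ i j, HasDerivAt (fun z => M z i j) (M' i j) 0) :
    HasDerivAt (fun z => (M z).det) M'.trace 0 := by
  let F : (Fin n → Fin n → ℂ) → ℂ := fun M => Matrix.det (Matrix.of M)
  have hcomp : ∀ K : ℂ → Fin n → Fin n → ℂ, K 0 = (fun i j => (1 : Matrix (Fin n) (Fin n) ℂ) i j) →
      (∀ i j, HasDerivAt (fun z => K z i j) (M' i j) 0) →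
      HasDerivAt (fun z => F (K z))
        (fderiv ℂ F (fun i j => (1 : Matrix (Fin n) (Fin n) ℂ) i j) fun i j => M' i j) 0 := by
    intro K hK0 hK
    have h1 : HasDerivAt K (fun i j => M' i j) 0 :=
      hasDerivAt_pi.2 fun i => hasDerivAt_pi.2 fun j => hK i j
    have h2 := (differentiable_matrix_det (n := n) (K 0)).hasFDerivAt
    have h3 := h2.comp_hasDerivAt 0 h1
    rw [hK0] at h3
    exact h3
  have h1 := hcomp (fun z i j => M z i j) (by rw [h0]) hM
  have h2 := hcomp (fun z i j => (1 + z • M') i j) (by simp) (by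
    intro i j
    simp only [Matrix.add_apply, Matrix.smul_apply, smul_eq_mul]
    simpa using (hasDerivAt_id' (0 : ℂ)).mul_const (M' i j))
  have h3 : HasDerivAt (fun z : ℂ => (1 + z • M').det) M'.trace 0 := by
    obtain ⟨p, hp⟩ : ∃ p : Polynomial ℂ,
        ∀ z : ℂ, (1 + z • M').det = 1 + M'.trace * z + p.eval z * z ^ 2 :=
      ⟨_, fun z => Matrix.det_one_add_smul z M'⟩
    simp only [hp]
    have h4 := (((hasDerivAt_id (0 : ℂ)).const_mul M'.trace).const_add 1).add
      ((p.hasDerivAt 0).mul ((hasDerivAt_id (0 : ℂ)).pow 2))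
    exact h4.congr_deriv (by simp)
  rw [← h2.unique h3]
  exact h1

theorem norm_deriv_le_of_forall_ne_zero {f : ℂ → ℂ} {r M : ℝ} {d : ℂ} (hr : 0 < r) (hM : 0 < M)
    (hf : DifferentiableOn ℂ f (Metric.ball 0 r)) (hne : ∀ z ∈ Metric.ball 0 r, f z ≠ 0)
    (hf0 : f 0 = 1) (hbound : ∀ z ∈ Metric.ball 0 r, ‖f z‖ ≤ Real.exp M)
    (hd : HasDerivAt f d 0) : ‖d‖ ≤ 4 * M / r := by
  have hf' : DifferentiableOn ℂ (deriv f) (Metric.ball 0 r) := hf.deriv Metric.isOpen_ball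
  obtain ⟨g, hg0, hg⟩ := (hf'.div hf hne).isExactOn_ball.with_val_at 0 0
  have h0mem : (0 : ℂ) ∈ Metric.ball (0 : ℂ) r := Metric.mem_ball_self hr
  have hexp : ∀ z ∈ Metric.ball (0 : ℂ) r, f z = Complex.exp (g z) := by
    have hconst : ∀ z ∈ Metric.ball (0 : ℂ) r,
        HasDerivAt (fun w => f w * Complex.exp (-g w)) 0 z := by
      intro z hz
      have h1 := (hf.differentiableAt (Metric.isOpen_ball.mem_nhds hz)).hasDerivAt
      refine (h1.mul (hg z hz).neg.cexp).congr_deriv ?_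
      have := hne z hz
      simp only [Pi.div_apply, Pi.neg_apply]
      field_simp
      ring
    intro z hz
    have h2 := (convex_ball (0 : ℂ) r).is_const_of_fderivWithin_eq_zero (𝕜 := ℂ)
      (f := fun w => f w * Complex.exp (-g w))
      (fun w hw => (hconst w hw).differentiableAt.differentiableWithinAt)
      (fun w hw => by
        rw [fderivWithin_of_isOpen Metric.isOpen_ball hw]
        ext
        simpa using (hconst w hw).deriv) hz h0mem
    simp only [hf0, hg0, neg_zero, Complex.exp_zero, mul_one, Complex.exp_neg] at h2
    field_simp at h2
    exact h2
  have hgd : DifferentiableOn ℂ g (Metric.ball 0 r) :=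
    fun z hz => (hg z hz).differentiableAt.differentiableWithinAt
  have hre : Set.MapsTo g (Metric.ball 0 r) {z | z.re ≤ M} := by
    intro z hz
    have h := hbound z hz
    rw [hexp z hz, Complex.norm_exp] at h
    exact Real.exp_le_exp.1 h
  have hg0' : HasDerivAt g d 0 := by
    have := hg 0 h0mem
    simpa [hd.deriv, hf0] using this
  refine hg0'.le_of_lip' (by positivity) ?_
  filter_upwards [Metric.ball_mem_nhds (0 : ℂ) (half_pos hr)] with z hz
  have hz' : ‖z‖ < r / 2 := by simpa using hz
  have hbc := Complex.borelCaratheodory_zero hM hgd hre hr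
    (z := z) (by simpa using hz'.trans (half_lt_self hr)) hg0
  rw [hg0, sub_zero, sub_zero]
  refine hbc.trans ?_
  rw [div_mul_eq_mul_div, div_le_div_iff₀ (by linarith) hr]
  have : 0 ≤ M * ‖z‖ := by positivity
  nlinarith

end Determinant

section Zerofree

variable {H : Type u} [NormedAddCommGroup H] [InnerProductSpace ℂ H] [CompleteSpace H]

theorem RankApprox.exists_norm_trace_le {X : H →L[ℂ] H} {c : ℝ} (hc : 0 < c)
    (hX : RankApprox X c) {N : ℕ} (hN : 1 ≤ N)
    (hspec : ∀ z : ℂ, 3 * c / N ≤ ‖z‖ → ∀ x, X x = z • x → x = 0) :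
    ∃ E : Submodule ℂ H, ∃ _ : FiniteDimensional ℂ E, Module.finrank ℂ E ≤ N ∧
      (∀ x ∈ Eᗮ, ‖X x‖ ≤ c / (N + 1) * ‖x‖) ∧
      ‖LinearMap.trace ℂ E (compress E X)‖ ≤ 24 * c := by
  obtain ⟨E, hE, hEN, hEX⟩ := hX N
  refine ⟨E, hE, hEN, hEX, ?_⟩
  have hN' : (0 : ℝ) < N := by exact_mod_cast hN
  set n := Module.finrank ℂ E
  obtain ⟨b, hb⟩ : ∃ b : OrthonormalBasis (Fin n) ℂ E, ∀ i, ‖X (b i)‖ ≤ c / (i + 1) :=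
    hX.exists_orthonormalBasis E
  set R : H →L[ℂ] H := X ∘L (1 - E.starProjection) with hR
  have hRn : ∀ x, ‖R x‖ ≤ c / (N + 1) * ‖x‖ := by
    intro x
    have h1 : x - E.starProjection x ∈ Eᗮ := E.sub_starProjection_mem_orthogonal x
    have h2 : ‖x - E.starProjection x‖ ≤ ‖x‖ := norm_sub_starProjection_le E x
    calc ‖R x‖ ≤ c / (N + 1) * ‖x - E.starProjection x‖ := hEX _ h1
      _ ≤ _ := by gcongr
  set r : ℝ := N / (3 * c) with hr
  have hrpos : 0 < r := by positivity
  have hzR : ∀ z ∈ Metric.ball (0 : ℂ) r, ∀ x, ‖z • R x‖ ≤ 1 / 3 * ‖x‖ := by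
    intro z hz x
    have hz' : ‖z‖ < r := by simpa using hz
    rw [norm_smul]
    calc ‖z‖ * ‖R x‖ ≤ r * (c / (N + 1) * ‖x‖) := by gcongr; exact hRn x
      _ = (N / (N + 1)) / 3 * ‖x‖ := by rw [hr]; field_simp
      _ ≤ 1 / 3 * ‖x‖ := by
        gcongr
        rw [div_le_one (by positivity)]; linarith
  have hunit : ∀ z ∈ Metric.ball (0 : ℂ) r, IsUnit (1 + z • R) := by
    intro z hz
    have h1 : ‖-(z • R)‖ < 1 := by
      rw [norm_neg]
      exact ((z • R).opNorm_le_bound (by norm_num) (hzR z hz)).trans_lt (by norm_num)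
    have := isUnit_one_sub_of_norm_lt_one h1
    rwa [sub_neg_eq_add] at this
  let S : ℂ → H →L[ℂ] H := fun z => Ring.inverse (1 + z • R)
  have hSmul : ∀ z ∈ Metric.ball (0 : ℂ) r, ∀ y, S z y + z • R (S z y) = y := by
    intro z hz y
    have := Ring.mul_inverse_cancel _ (hunit z hz)
    exact congrArg (fun L : H →L[ℂ] H => L y) this
  have hSn : ∀ z ∈ Metric.ball (0 : ℂ) r, ∀ y, ‖S z y‖ ≤ 2 * ‖y‖ := by
    intro z hz y
    have h1 := hSmul z hz y
    have h2 := hzR z hz (S z y)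
    have h3 : ‖S z y‖ ≤ ‖y‖ + ‖z • R (S z y)‖ := by
      have : S z y = y - z • R (S z y) := eq_sub_of_add_eq h1
      calc ‖S z y‖ = ‖y - z • R (S z y)‖ := by rw [← this]
        _ ≤ _ := norm_sub_le _ _
    linarith [norm_nonneg (S z y)]
  have hSd : ∀ z ∈ Metric.ball (0 : ℂ) r, DifferentiableAt ℂ S z := by
    intro z hz
    obtain ⟨w, hw⟩ := hunit z hz
    have h1 : DifferentiableAt ℂ (Ring.inverse : (H →L[ℂ] H) → _) (1 + z • R) := by
      rw [← hw]
      exact differentiableAt_inverse w.isUnit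
    exact h1.comp (f := fun z : ℂ => 1 + z • R) z (by fun_prop)
  let h : Fin n → Fin n → ℂ → ℂ := fun i j z => inner ℂ (b i : H) (S z (X (b j)))
  have hhd : ∀ i j, ∀ z ∈ Metric.ball (0 : ℂ) r, DifferentiableAt ℂ (h i j) z := by
    intro i j z hz
    have h1 : DifferentiableAt ℂ (fun z => S z (X (b j))) z :=
      (hSd z hz).clm_apply (differentiableAt_const _)
    exact (innerSL ℂ (b i : H)).differentiableAt.comp z h1
  let M : ℂ → Matrix (Fin n) (Fin n) ℂ := fun z => 1 + z • Matrix.of fun i j => h i j z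
  let G : ℂ → E →ₗ[ℂ] E := fun z => compress E (S z ∘L X)
  have hMG : ∀ z, (M z).det = LinearMap.det (1 + z • G z) := by
    intro z
    rw [← LinearMap.det_toMatrix b.toBasis]
    congr 1
    ext i j
    rw [LinearMap.toMatrix_apply]
    simp only [OrthonormalBasis.coe_toBasis, OrthonormalBasis.coe_toBasis_repr_apply,
      OrthonormalBasis.repr_apply_apply, LinearMap.add_apply, LinearMap.smul_apply,
      inner_add_right, inner_smul_right, Module.End.one_apply, G, inner_compress]
    simp [M, h, Matrix.one_apply, orthonormal_iff_ite.1 b.orthonormal i j]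
  have h0mem : (0 : ℂ) ∈ Metric.ball (0 : ℂ) r := Metric.mem_ball_self hrpos
  have hS0 : S 0 = 1 := by simp [S]
  have hder : HasDerivAt (fun z => (M z).det) (LinearMap.trace ℂ E (compress E X)) 0 := by
    have htr : LinearMap.trace ℂ E (compress E X) = (Matrix.of fun i j => h i j 0).trace := by
      simp only [LinearMap.trace_eq_sum_inner _ b, Matrix.trace, inner_compress]
      simp [h, hS0]
    rw [htr]
    refine hasDerivAt_det_of_eq_one (by simp [M]) fun i j => ?_
    have := ((hasDerivAt_id (0 : ℂ)).mul (hhd i j 0 h0mem).hasDerivAt).const_add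
      ((1 : Matrix (Fin n) (Fin n) ℂ) i j)
    simpa [M] using this
  have hdiff : DifferentiableOn ℂ (fun z => (M z).det) (Metric.ball 0 r) := by
    intro z hz
    have h1 : DifferentiableAt ℂ (fun z => (fun i j => M z i j : Fin n → Fin n → ℂ)) z := by
      refine differentiableAt_pi.2 fun i => differentiableAt_pi.2 fun j => ?_
      have := (differentiableAt_id.mul (hhd i j z hz)).const_add
        ((1 : Matrix (Fin n) (Fin n) ℂ) i j)
      simpa [M] using this
    exact ((differentiable_matrix_det _).comp z h1).differentiableWithinAt
  have hne : ∀ z ∈ Metric.ball (0 : ℂ) r, (M z).det ≠ 0 := by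
    intro z hz hdet
    rw [hMG] at hdet
    obtain ⟨x, hx, hx0⟩ := Submodule.exists_mem_ne_zero_of_ne_bot
      ((LinearMap.det_eq_zero_iff_ker_ne_bot).1 hdet)
    have hx1 : x + z • G z x = 0 := by simpa using hx
    have hz0 : z ≠ 0 := by
      rintro rfl
      simp at hx1
      exact hx0 hx1
    set y := S z (X x) with hy
    have hPy : E.starProjection (-(z • y)) = x := by
      have h1 : E.starProjection y = (G z x : H) := rfl
      rw [map_neg, map_smul, h1, neg_eq_iff_add_eq_zero, add_comm]
      exact congrArg Subtype.val hx1
    have h2 := hSmul z hz (X x)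
    rw [← hy] at h2
    have h3 : R y = X y + z⁻¹ • X x := by
      have h4 : E.starProjection y = -(z⁻¹ • (x : H)) := by
        rw [← hPy, map_neg, map_smul]
        simp [hz0]
      simp [hR, h4]
    have h5 : X y = (-z⁻¹) • y := by
      rw [h3, smul_add, smul_inv_smul₀ hz0, ← add_assoc, add_eq_right] at h2
      rw [neg_smul, eq_neg_iff_add_eq_zero]
      have := congrArg (fun w => z⁻¹ • w) h2
      simpa [hz0, add_comm] using this
    have hz' : ‖z‖ < r := by simpa using hz
    have h6 := hspec (-z⁻¹) (by
      rw [norm_neg, norm_inv, ← inv_div]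
      exact inv_anti₀ (norm_pos_iff.2 hz0) hz'.le) y h5
    apply hx0
    apply Subtype.ext
    rw [← hPy, h6]
    simp
  have hbound : ∀ z ∈ Metric.ball (0 : ℂ) r, ‖(M z).det‖ ≤ Real.exp (2 * N) := by
    intro z hz
    have hz' : ‖z‖ < r := by simpa using hz
    rw [hMG]
    calc ‖LinearMap.det (1 + z • G z)‖ ≤ ∏ i, ‖(1 + z • G z) (b i)‖ := norm_det_le_prod b _
      _ ≤ ∏ i : Fin n, 2 * N / ((i : ℕ) + 1 : ℝ) := by
          refine Finset.prod_le_prod (fun _ _ => norm_nonneg _) fun i _ => ?_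
          have hi : ((i : ℕ) + 1 : ℝ) ≤ N := by exact_mod_cast (Nat.succ_le_of_lt i.2).trans hEN
          have hi0 : (0 : ℝ) < (i : ℕ) + 1 := by positivity
          have h1 : ‖G z (b i)‖ ≤ 2 * (c / ((i : ℕ) + 1)) :=
            (norm_compress_le E _ _).trans ((hSn z hz _).trans (by gcongr; exact hb i))
          calc ‖(1 + z • G z) (b i)‖ ≤ ‖b i‖ + ‖z • G z (b i)‖ := by
                simpa using norm_add_le (b i) (z • G z (b i))
            _ ≤ 1 + r * (2 * (c / ((i : ℕ) + 1))) := by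
                rw [norm_smul, b.orthonormal.1 i]
                gcongr
            _ = 1 + 2 / 3 * (N / ((i : ℕ) + 1)) := by rw [hr]; field_simp
            _ ≤ N / ((i : ℕ) + 1) + N / ((i : ℕ) + 1) := by
                have h2 : 1 ≤ N / ((i : ℕ) + 1 : ℝ) := (one_le_div hi0).2 hi
                linarith
            _ = _ := by ring
      _ = ∏ i ∈ Finset.range n, 2 * N / ((i : ℕ) + 1 : ℝ) :=
          Fin.prod_univ_eq_prod_range (fun i : ℕ => 2 * N / (i + 1 : ℝ)) n
      _ = (2 * N) ^ n / n.factorial := by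
          rw [Finset.prod_div_distrib, Finset.prod_const, Finset.card_range,
            ← Finset.prod_range_add_one_eq_factorial]
          push_cast
          rfl
      _ ≤ Real.exp (2 * N) := Real.pow_div_factorial_le_exp _ (by positivity) n
  have := norm_deriv_le_of_forall_ne_zero hrpos (by positivity : (0 : ℝ) < 2 * N) hdiff hne
    (by simp [M]) hbound hder
  refine this.trans_eq ?_
  rw [hr]
  field_simp
  norm_num

end Zerofree

section Stability

variable {H : Type u} [NormedAddCommGroup H] [InnerProductSpace ℂ H]

theorem RankApprox.mono {T : H →L[ℂ] H} {c c' : ℝ} (hT : RankApprox T c) (h : c ≤ c') :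
    RankApprox T c' := by
  intro k
  obtain ⟨E, hE, hk, hb⟩ := hT k
  exact ⟨E, hE, hk, fun x hx => (hb x hx).trans (by gcongr)⟩

theorem MemWeak.exists_rankApprox {T : H →L[ℂ] H} (hT : MemWeak 1 T) :
    ∃ c, 0 < c ∧ RankApprox T c := by
  obtain ⟨-, C, hC⟩ := hT
  refine ⟨max ‖T‖ C + 1, by positivity, fun k => ?_⟩
  have hcT : ‖T‖ ≤ max ‖T‖ C + 1 := (le_max_left _ _).trans (by linarith)
  have hcC : C < max ‖T‖ C + 1 := (le_max_right _ _).trans_lt (by linarith)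
  set c := max ‖T‖ C + 1
  rcases Nat.eq_zero_or_pos k with rfl | hk
  · refine ⟨⊥, inferInstance, by simp, fun x _ => ?_⟩
    simpa using T.le_of_opNorm_le hcT x
  by_cases hrank : (k : Cardinal) ≤ Module.rank ℂ H
  · obtain ⟨s, hs, hli⟩ := Module.le_rank_iff_exists_finset.1 hrank
    have : Nonempty {E : Submodule ℂ H // Module.finrank ℂ E = k} :=
      ⟨⟨Submodule.span ℂ (s : Set H), (finrank_span_finset_eq_card hli).trans hs⟩⟩
    have hsv : sv T k < c / (k + 1) := by
      have h := hC k
      rw [div_one, Real.rpow_one] at h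
      rw [lt_div_iff₀ (by positivity), mul_comm]
      exact h.trans_lt hcC
    obtain ⟨⟨E, hE⟩, hEsup⟩ := exists_lt_of_ciInf_lt hsv
    refine ⟨E, FiniteDimensional.of_finrank_pos (by omega), hE.le, fun x hx => ?_⟩
    rcases eq_or_ne x 0 with rfl | hx0
    · simp
    have hx' : ‖x‖ ≠ 0 := norm_ne_zero_iff.2 hx0
    have hbdd : BddAbove (Set.range fun ξ : {ξ : H // ξ ∈ Eᗮ ∧ ‖ξ‖ = 1} => ‖T ξ.1‖) := by
      refine ⟨‖T‖, ?_⟩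
      rintro _ ⟨ξ, rfl⟩
      simpa [ξ.2.2] using T.le_opNorm ξ.1
    have h1 := (le_ciSup hbdd ⟨((‖x‖ : ℂ)⁻¹) • x, Submodule.smul_mem _ _ hx,
      norm_smul_inv_norm hx0⟩).trans hEsup.le
    rw [map_smul, norm_smul, norm_inv, Complex.norm_real, norm_norm,
      inv_mul_le_iff₀ (by positivity), mul_comm] at h1
    exact h1
  · have hlt : Module.rank ℂ H < k := not_le.1 hrank
    have : FiniteDimensional ℂ H :=
      Module.rank_lt_aleph0_iff.1 (hlt.trans Cardinal.natCast_lt_aleph0)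
    refine ⟨⊤, inferInstance, ?_, fun x hx => ?_⟩
    · rw [finrank_top]
      rw [← Module.finrank_eq_rank, Nat.cast_lt] at hlt
      exact hlt.le
    · have : x = 0 := by simpa using hx
      simp [this]

theorem RankApprox.add {S T : H →L[ℂ] H} {c : ℝ} (hc : 0 < c) (hS : RankApprox S c)
    (hT : RankApprox T c) : RankApprox (S + T) (4 * c) := by
  intro k
  obtain ⟨E, hE, hEk, hEb⟩ := hS (k / 2)
  obtain ⟨F, hF, hFk, hFb⟩ := hT (k / 2)
  refine ⟨E ⊔ F, inferInstance, ?_, fun x hx => ?_⟩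
  · have := Submodule.finrank_add_le_finrank_add_finrank E F
    omega
  have h1 := hEb x (Submodule.orthogonal_le le_sup_left hx)
  have h2 := hFb x (Submodule.orthogonal_le le_sup_right hx)
  have h3 : ((k : ℝ) + 1) ≤ 2 * ((k / 2 : ℕ) + 1) := by
    have : k + 1 ≤ 2 * (k / 2 + 1) := by omega
    exact_mod_cast this
  have h4 : 2 * (c / ((k / 2 : ℕ) + 1)) ≤ 4 * c / (k + 1) := by
    rw [mul_div_assoc', div_le_div_iff₀ (by positivity) (by positivity)]
    nlinarith
  calc ‖(S + T) x‖ ≤ ‖S x‖ + ‖T x‖ := norm_add_le _ _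
    _ ≤ 2 * (c / ((k / 2 : ℕ) + 1)) * ‖x‖ := by linarith
    _ ≤ _ := by gcongr

theorem RankApprox.corner {T : H →L[ℂ] H} {c : ℝ} (hc : 0 < c) (hT : RankApprox T c)
    (V : Submodule ℂ H) [FiniteDimensional ℂ V] :
    RankApprox ((1 - V.starProjection) ∘L T ∘L (1 - V.starProjection)) c := by
  intro k
  obtain ⟨E, hE, hEk, hEb⟩ := hT k
  refine ⟨E.map ((1 - V.starProjection : H →L[ℂ] H) : H →ₗ[ℂ] H), inferInstance,
    (Submodule.finrank_map_le _ _).trans hEk, fun x hx => ?_⟩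
  have hxE : x - V.starProjection x ∈ Eᗮ := by
    rw [Submodule.mem_orthogonal] at hx ⊢
    intro e he
    have := hx _ (Submodule.mem_map_of_mem he)
    simpa [inner_sub_left, inner_sub_right, Submodule.inner_starProjection_left_eq_right] using this
  calc ‖((1 - V.starProjection) ∘L T ∘L (1 - V.starProjection)) x‖
      ≤ ‖T (x - V.starProjection x)‖ := norm_sub_starProjection_le V _
    _ ≤ c / (k + 1) * ‖x - V.starProjection x‖ := hEb _ hxE
    _ ≤ _ := by gcongr; exact norm_sub_starProjection_le V x

end Stability

section Trace

variable {H : Type u} [NormedAddCommGroup H] [InnerProductSpace ℂ H]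

/-- The trace of the compression of `T` to `W`. -/
noncomputable def compressTrace (W : Submodule ℂ H) [FiniteDimensional ℂ W] :
    (H →L[ℂ] H) →ₗ[ℂ] ℂ where
  toFun T := LinearMap.trace ℂ W (compress W T)
  map_add' S T := by
    rw [← map_add]; congr 1; ext x; simp [compress]
  map_smul' a T := by
    rw [RingHom.id_apply, ← map_smul]; congr 1; ext x; simp [compress]

theorem norm_compressTrace_le {W : Submodule ℂ H} [FiniteDimensional ℂ W] {T : H →L[ℂ] H} {K : ℝ}
    (hT : ∀ x, ‖T x‖ ≤ K * ‖x‖) : ‖compressTrace W T‖ ≤ Module.finrank ℂ W * K := by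
  change ‖LinearMap.trace ℂ W (compress W T)‖ ≤ _
  let b := stdOrthonormalBasis ℂ W
  rw [LinearMap.trace_eq_sum_inner _ b]
  calc _ ≤ ∑ _i : Fin (Module.finrank ℂ W), K := norm_sum_le_of_le _ fun i _ => by
        have h1 : ‖(b i : H)‖ = 1 := b.orthonormal.1 i
        have h2 := hT (b i)
        rw [inner_compress]
        refine (norm_inner_le_norm _ _).trans ?_
        rw [h1, mul_one] at h2
        rwa [h1, one_mul]
    _ = _ := by simp

theorem compressTrace_comp_starProjection {E W : Submodule ℂ H} [FiniteDimensional ℂ E]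
    [FiniteDimensional ℂ W] (h : E ≤ W) (T : H →L[ℂ] H) :
    compressTrace W (T ∘L E.starProjection) = compressTrace E T := by
  let f : E →ₗ[ℂ] W := (W.orthogonalProjectionOnto ∘L T ∘L E.subtypeL : E →L[ℂ] W)
  let g : W →ₗ[ℂ] E := (E.orthogonalProjectionOnto ∘L W.subtypeL : W →L[ℂ] E)
  have h1 : compress W (T ∘L E.starProjection) = f ∘ₗ g := rfl
  have h2 : compress E T = g ∘ₗ f :=
    LinearMap.ext fun x => (Submodule.orthogonalProjectionOnto_starProjection_of_le h (T x)).symm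
  change LinearMap.trace ℂ W (compress W (T ∘L E.starProjection)) =
    LinearMap.trace ℂ E (compress E T)
  rw [h1, h2, LinearMap.trace_comp_comm']

theorem compressTrace_offDiagonal {V W : Submodule ℂ H} [FiniteDimensional ℂ V]
    [FiniteDimensional ℂ W] (h : V ≤ W) (T : H →L[ℂ] H) :
    compressTrace W (V.starProjection ∘L T ∘L (1 - V.starProjection)) = 0 := by
  let f : V →ₗ[ℂ] W := (W.orthogonalProjectionOnto ∘L V.subtypeL : V →L[ℂ] W)
  let g : W →ₗ[ℂ] V :=
    (V.orthogonalProjectionOnto ∘L T ∘L (1 - V.starProjection) ∘L W.subtypeL : W →L[ℂ] V)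
  have h1 : compress W (V.starProjection ∘L T ∘L (1 - V.starProjection)) = f ∘ₗ g := rfl
  have h2 : g ∘ₗ f = 0 := by
    ext x
    have hx : W.starProjection (x : H) = x := Submodule.starProjection_eq_self_iff.2 (h x.2)
    have hx' : V.starProjection (x : H) = x := Submodule.starProjection_eq_self_iff.2 x.2
    have : g (f x) = V.orthogonalProjectionOnto
      (T (W.starProjection (x : H) - V.starProjection (W.starProjection (x : H)))) := rfl
    rw [LinearMap.comp_apply, this, hx, hx', sub_self, map_zero, map_zero]
    rfl
  change LinearMap.trace ℂ W (compress W _) = 0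
  rw [h1, LinearMap.trace_comp_comm', h2, map_zero]

variable [CompleteSpace H]

theorem RankApprox.exists_norm_compressTrace_sub_sum_le {T : H →L[ℂ] H} {c : ℝ} (hc : 0 < c)
    (hT : RankApprox T c) {lam : ℕ → ℂ} (hlam : IsEigenvalueSequence T lam) {N : ℕ}
    (hN : 1 ≤ N) :
    ∃ U : Submodule ℂ H, FiniteDimensional ℂ U ∧ Module.finrank ℂ U ≤ 2 * N ∧
      ∀ W : Submodule ℂ H, ∀ _ : FiniteDimensional ℂ W, U ≤ W → Module.finrank ℂ W ≤ 6 * N →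
        ‖compressTrace W T - ∑ j ∈ Finset.range N, lam j‖ ≤ 33 * c := by
  have hN' : (0 : ℝ) < N := by exact_mod_cast hN
  obtain ⟨V, hV, hVo, hVmax⟩ := hT.exists_maximal_outerInvariant hc hN
  have hVN := hVo.finrank_le hc hT hN
  set X : H →L[ℂ] H := (1 - V.starProjection) ∘L T ∘L (1 - V.starProjection) with hXdef
  have hX : RankApprox X c := hT.corner hc V
  have hspec : ∀ z : ℂ, 3 * c / N ≤ ‖z‖ → ∀ x, X x = z • x → x = 0 := by
    intro z hz x hx
    have hz0 : z ≠ 0 := norm_pos_iff.1 (lt_of_lt_of_le (by positivity) hz)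
    have hXV : ∀ y, V.starProjection (X y) = 0 := by
      intro y
      have : X y = T (y - V.starProjection y) - V.starProjection (T (y - V.starProjection y)) := rfl
      rw [this, map_sub, Submodule.starProjection_eq_self_iff.2 (Submodule.starProjection_apply_mem _ _),
        sub_self]
    have hPx : V.starProjection x = 0 := by
      have h1 := hXV x
      rw [hx, map_smul] at h1
      exact (smul_eq_zero.1 h1).resolve_left hz0
    have h2 : T x - z • x = V.starProjection (T x) := by
      have : X x = T (x - V.starProjection x) - V.starProjection (T (x - V.starProjection x)) := rfl
      rw [← hx, this, hPx, sub_zero]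
      abel
    have hxV : x ∈ V := hVmax z hz x (h2 ▸ Submodule.starProjection_apply_mem _ _)
    rw [← hPx, Submodule.starProjection_eq_self_iff.2 hxV]
  obtain ⟨E, hE, hEN, hEX, hEtr⟩ := hX.exists_norm_trace_le hc hN hspec
  refine ⟨V ⊔ E, inferInstance, ?_, fun W hW hUW hWN => ?_⟩
  · have := Submodule.finrank_add_le_finrank_add_finrank V E
    omega
  have hdecomp : T = T ∘L V.starProjection + V.starProjection ∘L T ∘L (1 - V.starProjection)
      + (X ∘L E.starProjection + X ∘L (1 - E.starProjection)) := by
    ext x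
    simp [hXdef]
    abel
  have htr : compressTrace W T = compressTrace V T + 0
      + (compressTrace E X + compressTrace W (X ∘L (1 - E.starProjection))) := by
    conv_lhs => rw [hdecomp]
    rw [map_add, map_add, map_add, compressTrace_comp_starProjection (le_sup_left.trans hUW),
      compressTrace_offDiagonal (le_sup_left.trans hUW),
      compressTrace_comp_starProjection (le_sup_right.trans hUW)]
  have h1 : ‖compressTrace V T - ∑ j ∈ Finset.range N, lam j‖ ≤ 3 * c := by
    refine (norm_trace_compress_sub_sum_le (by positivity) hVo hVmax hVN hlam).trans_eq ?_
    field_simp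
  have h2 : ‖compressTrace W (X ∘L (1 - E.starProjection))‖ ≤ 6 * c := by
    refine (norm_compressTrace_le (K := c / (N + 1)) fun x => ?_).trans ?_
    · exact (hEX _ (E.sub_starProjection_mem_orthogonal x)).trans
        (by gcongr; exact norm_sub_starProjection_le E x)
    · have h3 : (Module.finrank ℂ W : ℝ) ≤ 6 * N := by exact_mod_cast hWN
      rw [mul_div_assoc', div_le_iff₀ (by positivity)]
      nlinarith
  have h3 : ‖compressTrace E X‖ ≤ 24 * c := hEtr
  rw [htr]
  calc _ = ‖(compressTrace V T - ∑ j ∈ Finset.range N, lam j) + compressTrace E X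
        + compressTrace W (X ∘L (1 - E.starProjection))‖ := by congr 1; ring
    _ ≤ _ := norm_add₃_le
    _ ≤ 33 * c := by linarith

end Trace

/-- For `A, B ∈ 𝓛_{1,∞}` on a separable Hilbert space and any eigenvalue sequences of `A`, `B`
and `A + B`, the partial sums satisfy
`∑_{j<N} λ_j(A+B) = ∑_{j<N} λ_j(A) + ∑_{j<N} λ_j(B) + O(1)`. -/
theorem eigenvalue_sums_additive {H : Type u} [NormedAddCommGroup H] [InnerProductSpace ℂ H]
    [CompleteSpace H] [TopologicalSpace.SeparableSpace H]
    (A B : H →L[ℂ] H) (hA : MemWeak 1 A) (hB : MemWeak 1 B)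
    (lamA lamB lamAB : ℕ → ℂ)
    (hlA : IsEigenvalueSequence A lamA) (hlB : IsEigenvalueSequence B lamB)
    (hlAB : IsEigenvalueSequence (A + B) lamAB) :
    ∃ C : ℝ, ∀ N : ℕ, 1 ≤ N →
      ‖(∑ j ∈ Finset.range N, lamAB j) - (∑ j ∈ Finset.range N, lamA j) -
        ∑ j ∈ Finset.range N, lamB j‖ ≤ C := by
  obtain ⟨a, ha, hA'⟩ := hA.exists_rankApprox
  obtain ⟨b, hb, hB'⟩ := hB.exists_rankApprox
  have hm : 0 < max a b := lt_max_of_lt_left ha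
  have hAm := hA'.mono (le_max_left a b)
  have hBm := hB'.mono (le_max_right a b)
  refine ⟨33 * (4 * max a b) + 33 * max a b + 33 * max a b, fun N hN => ?_⟩
  obtain ⟨U₁, hU₁, hd₁, h₁⟩ := hAm.exists_norm_compressTrace_sub_sum_le hm hlA hN
  obtain ⟨U₂, hU₂, hd₂, h₂⟩ := hBm.exists_norm_compressTrace_sub_sum_le hm hlB hN
  obtain ⟨U₃, hU₃, hd₃, h₃⟩ :=
    (hAm.add hm hBm).exists_norm_compressTrace_sub_sum_le (by positivity) hlAB hN
  have hd : Module.finrank ℂ (U₁ ⊔ U₂ ⊔ U₃ : Submodule ℂ H) ≤ 6 * N := by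
    have e₁ := Submodule.finrank_add_le_finrank_add_finrank (U₁ ⊔ U₂) U₃
    have e₂ := Submodule.finrank_add_le_finrank_add_finrank U₁ U₂
    omega
  have k₁ := h₁ (U₁ ⊔ U₂ ⊔ U₃) inferInstance (le_sup_left.trans le_sup_left) hd
  have k₂ := h₂ (U₁ ⊔ U₂ ⊔ U₃) inferInstance (le_sup_right.trans le_sup_left) hd
  have k₃ := h₃ (U₁ ⊔ U₂ ⊔ U₃) inferInstance le_sup_right hd
  rw [map_add] at k₃
  set tA := compressTrace (U₁ ⊔ U₂ ⊔ U₃) A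
  set tB := compressTrace (U₁ ⊔ U₂ ⊔ U₃) B
  calc _ = ‖-(tA + tB - ∑ j ∈ Finset.range N, lamAB j) + (tA - ∑ j ∈ Finset.range N, lamA j)
        + (tB - ∑ j ∈ Finset.range N, lamB j)‖ := by congr 1; ring
    _ ≤ _ := norm_add₃_le
    _ ≤ _ := by rw [norm_neg]; gcongr
end
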